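/- arXiv:2310.20560 — 2 statements merged into one kernel-verified Lean document; each statement's English description precedes it below -/
import Mathlib

section
/- Let m>0 and let f: ℝ³×ℝ³ → ℂ be a Schwartz function. Define I₋(x) = (2π)^{-3} ∫_{ℝ³}∫_{ℝ³} f(p⃗,q⃗) e^{-i[(ω_m(p⃗)−ω_m(q⃗))x⁰ − (p⃗−q⃗)·x⃗]} (m²/(ω_m(p⃗)ω_m(q⃗))) d³p⃗ d³q⃗. Then: (i) there is a constant C (depending on f, m) such that for every x ∈ ℝ⁴ with x·x ≥ 1, writing λ = sgn(x⁰)(x·x)^{1/2} and u⃗ = x⃗/λ, |I₋(x) − (m/|λ|)³ f(mu⃗, mu⃗)| ≤ C(1+|x|)^{-4}; and (ii) for every N ≥ 0 there is C_N such that |I₋(x)| ≤ C_N(1+|x|)^{-N} for all x with x·x < 1. -/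
/-!
Statement 2: asymptotics of the oscillatory integral
`I₋(x) = (2π)^{-3} ∫∫ f(p⃗,q⃗) e^{-i[(ω_m(p⃗)−ω_m(q⃗))x⁰ − (p⃗−q⃗)·x⃗]} m²/(ω_m(p⃗)ω_m(q⃗)) d³p⃗ d³q⃗`.
-/

open MeasureTheory Real Complex
open scoped InnerProductSpace

noncomputable section

abbrev V3 := EuclideanSpace ℝ (Fin 3)

def ωm (m : ℝ) (p : V3) : ℝ := Real.sqrt (m ^ 2 + ‖p‖ ^ 2)

def Iminus (m : ℝ) (f : SchwartzMap (V3 × V3) ℂ) (x0 : ℝ) (xv : V3) : ℂ :=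
  ((((2 * π) ^ 3)⁻¹ : ℝ) : ℂ) *
    ∫ p : V3, ∫ q : V3, f (p, q) *
      Complex.exp (-Complex.I *
        (((ωm m p - ωm m q) * x0 - (⟪p, xv⟫_ℝ - ⟪q, xv⟫_ℝ) : ℝ) : ℂ)) *
      (((m ^ 2 / (ωm m p * ωm m q) : ℝ)) : ℂ)

/-- In the coordinates `k = p - q`, `u = v / √(1 - ‖v‖²)` with `v = (p + q) / (ω(p) + ω(q))`, the
length factor for which `p + q = energyScale m k u • u`. -/
def energyScale (m : ℝ) (k u : V3) : ℝ :=
  √(4 * m ^ 2 + ‖k‖ ^ 2 - ⟪k, u⟫_ℝ ^ 2 / (1 + ‖u‖ ^ 2))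

lemma hasTemperateGrowth_one_add_sum_sq_rpow {D ι : Type*} [NormedAddCommGroup D]
    [NormedSpace ℝ D] [Fintype ι] {w : ι → D → ℝ} (hw : ∀ i, (w i).HasTemperateGrowth) (r : ℝ) :
    (fun x ↦ (1 + ∑ i, w i x ^ 2) ^ r).HasTemperateGrowth := by
  classical
  have hW : (fun x ↦ ∑ i, w i x • EuclideanSpace.single i (1 : ℝ)).HasTemperateGrowth :=
    .sum fun i _ ↦ (hw i).fun_smul (.const _)
  have hnorm (x : D) : ‖∑ i, w i x • EuclideanSpace.single i (1 : ℝ)‖ ^ 2 = ∑ i, w i x ^ 2 := by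
    simp [EuclideanSpace.norm_sq_eq, Finset.sum_apply, Pi.single_apply]
  simp_rw [← hnorm]
  exact (Function.hasTemperateGrowth_one_add_norm_sq_rpow (EuclideanSpace ℝ ι) r).comp hW

lemma inner_sq_le_norm_sq_mul (k u : V3) : ⟪k, u⟫_ℝ ^ 2 ≤ ‖k‖ ^ 2 * ‖u‖ ^ 2 := by
  rw [← mul_pow, ← sq_abs]
  gcongr
  exact abs_real_inner_le_norm k u

lemma inner_sq_div_le (k u : V3) : ⟪k, u⟫_ℝ ^ 2 / (1 + ‖u‖ ^ 2) ≤ ‖k‖ ^ 2 := by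
  rw [div_le_iff₀ (by positivity)]
  nlinarith [inner_sq_le_norm_sq_mul k u, sq_nonneg ‖k‖]

lemma two_mul_le_energyScale (m : ℝ) (k u : V3) : 2 * m ≤ energyScale m k u := by
  apply Real.le_sqrt_of_sq_le
  nlinarith [inner_sq_div_le k u]

lemma energyScale_sq (m : ℝ) (k u : V3) :
    energyScale m k u ^ 2 = 4 * m ^ 2 + ‖k‖ ^ 2 - ⟪k, u⟫_ℝ ^ 2 / (1 + ‖u‖ ^ 2) :=
  Real.sq_sqrt (by nlinarith [inner_sq_div_le k u])

lemma hasTemperateGrowth_coord_fst (i : Fin 3) :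
    (fun z : V3 × V3 ↦ z.1 i).HasTemperateGrowth :=
  ((EuclideanSpace.proj (𝕜 := ℝ) i).comp (.fst ℝ V3 V3)).hasTemperateGrowth

lemma hasTemperateGrowth_coord_snd (i : Fin 3) :
    (fun z : V3 × V3 ↦ z.2 i).HasTemperateGrowth :=
  ((EuclideanSpace.proj (𝕜 := ℝ) i).comp (.snd ℝ V3 V3)).hasTemperateGrowth

lemma hasTemperateGrowth_one_add_snd_sq_rpow (r : ℝ) :
    (fun z : V3 × V3 ↦ (1 + ‖z.2‖ ^ 2) ^ r).HasTemperateGrowth :=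
  (Function.hasTemperateGrowth_one_add_norm_sq_rpow V3 r).comp
    (ContinuousLinearMap.snd ℝ V3 V3).hasTemperateGrowth

/-- The coordinates of `u`, `k / (2m)` and `(k × u) / (2m)`: the squared norms of these three
vectors add up to `(1 + ‖u‖²) energyScale² / (4m²) - 1`. -/
def energyVector (m : ℝ) : Fin 9 → V3 × V3 → ℝ :=
  ![fun z ↦ z.2 0, fun z ↦ z.2 1, fun z ↦ z.2 2,
    fun z ↦ (2 * m)⁻¹ * z.1 0, fun z ↦ (2 * m)⁻¹ * z.1 1, fun z ↦ (2 * m)⁻¹ * z.1 2,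
    fun z ↦ (2 * m)⁻¹ * (z.1 1 * z.2 2 - z.1 2 * z.2 1),
    fun z ↦ (2 * m)⁻¹ * (z.1 2 * z.2 0 - z.1 0 * z.2 2),
    fun z ↦ (2 * m)⁻¹ * (z.1 0 * z.2 1 - z.1 1 * z.2 0)]

lemma hasTemperateGrowth_energyVector (m : ℝ) (i : Fin 9) :
    (energyVector m i).HasTemperateGrowth := by
  have hk := hasTemperateGrowth_coord_fst
  have hu := hasTemperateGrowth_coord_snd
  have hc : (fun _ : V3 × V3 ↦ (2 * m)⁻¹).HasTemperateGrowth := .const _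
  fin_cases i
  · exact hu 0
  · exact hu 1
  · exact hu 2
  · exact hc.fun_mul (hk 0)
  · exact hc.fun_mul (hk 1)
  · exact hc.fun_mul (hk 2)
  · exact hc.fun_mul (((hk 1).fun_mul (hu 2)).fun_sub ((hk 2).fun_mul (hu 1)))
  · exact hc.fun_mul (((hk 2).fun_mul (hu 0)).fun_sub ((hk 0).fun_mul (hu 2)))
  · exact hc.fun_mul (((hk 0).fun_mul (hu 1)).fun_sub ((hk 1).fun_mul (hu 0)))

lemma one_add_sum_energyVector_sq {m : ℝ} (hm : 0 < m) (z : V3 × V3) :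
    1 + ∑ i, energyVector m i z ^ 2 =
      (1 + ‖z.2‖ ^ 2) * (energyScale m z.1 z.2 ^ 2 / (4 * m ^ 2)) := by
  have hu : ‖z.2‖ ^ 2 = z.2 0 ^ 2 + z.2 1 ^ 2 + z.2 2 ^ 2 := by
    simp [EuclideanSpace.norm_sq_eq, Fin.sum_univ_three]
  have hk : ‖z.1‖ ^ 2 = z.1 0 ^ 2 + z.1 1 ^ 2 + z.1 2 ^ 2 := by
    simp [EuclideanSpace.norm_sq_eq, Fin.sum_univ_three]
  have hi : ⟪z.1, z.2⟫_ℝ = z.1 0 * z.2 0 + z.1 1 * z.2 1 + z.1 2 * z.2 2 := by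
    simp [PiLp.inner_apply, Fin.sum_univ_three, mul_comm]
  have h1 : 1 + ‖z.2‖ ^ 2 ≠ 0 := by positivity
  have hs : (1 + ‖z.2‖ ^ 2) * energyScale m z.1 z.2 ^ 2 =
      (1 + ‖z.2‖ ^ 2) * (4 * m ^ 2 + ‖z.1‖ ^ 2) - ⟪z.1, z.2⟫_ℝ ^ 2 := by
    rw [energyScale_sq]
    field_simp
  rw [← mul_div_assoc, hs, hu, hk, hi]
  simp [energyVector, Fin.sum_univ_succ]
  field_simp
  ring

lemma hasTemperateGrowth_energyScale {m : ℝ} (hm : 0 < m) :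
    (fun z : V3 × V3 ↦ energyScale m z.1 z.2).HasTemperateGrowth := by
  have h : (fun z : V3 × V3 ↦ energyScale m z.1 z.2) = fun z ↦
      2 * m * ((1 + ‖z.2‖ ^ 2) ^ (-(1 / 2) : ℝ) *
        (1 + ∑ i, energyVector m i z ^ 2) ^ (1 / 2 : ℝ)) := by
    funext z
    have h0 : 0 < energyScale m z.1 z.2 := by linarith [two_mul_le_energyScale m z.1 z.2]
    rw [one_add_sum_energyVector_sq hm, Real.mul_rpow (by positivity) (by positivity),
      ← mul_assoc _ _ ((_ : ℝ) ^ (1 / 2 : ℝ)), ← Real.rpow_add (by positivity),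
      ← Real.sqrt_eq_rpow (_ / _), Real.sqrt_div (by positivity), Real.sqrt_sq h0.le,
      show 4 * m ^ 2 = (2 * m) ^ 2 by ring, Real.sqrt_sq (by positivity)]
    norm_num
    field_simp
  rw [h]
  exact (Function.HasTemperateGrowth.const (2 * m)).fun_mul
    ((hasTemperateGrowth_one_add_snd_sq_rpow _).fun_mul
      (hasTemperateGrowth_one_add_sum_sq_rpow (hasTemperateGrowth_energyVector m) _))

/-- The momenta `(p, q)` as functions of `(k, u)`. -/
def momenta (m : ℝ) (z : V3 × V3) : V3 × V3 :=
  ((1 / 2 : ℝ) • (energyScale m z.1 z.2 • z.2 + z.1),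
    (1 / 2 : ℝ) • (energyScale m z.1 z.2 • z.2 - z.1))

lemma hasTemperateGrowth_momenta {m : ℝ} (hm : 0 < m) : (momenta m).HasTemperateGrowth := by
  have hk := (ContinuousLinearMap.fst ℝ V3 V3).hasTemperateGrowth
  have hu := (ContinuousLinearMap.snd ℝ V3 V3).hasTemperateGrowth
  have hs := (hasTemperateGrowth_energyScale hm).fun_smul hu
  have hp := (Function.HasTemperateGrowth.const (E := V3 × V3) (1 / 2 : ℝ)).fun_smul (hs.fun_add hk)
  have hq := (Function.HasTemperateGrowth.const (E := V3 × V3) (1 / 2 : ℝ)).fun_smul (hs.fun_sub hk)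
  convert ((ContinuousLinearMap.inl ℝ V3 V3).hasTemperateGrowth.comp hp).fun_add
    ((ContinuousLinearMap.inr ℝ V3 V3).hasTemperateGrowth.comp hq) using 2 with z
  simp [momenta]

lemma norm_le_momenta {m : ℝ} (hm : 0 < m) (z : V3 × V3) :
    ‖z‖ ≤ (2 + m⁻¹) * (1 + ‖momenta m z‖) ^ 1 := by
  set a := momenta m z with ha
  have hk : z.1 = a.1 - a.2 := by
    rw [ha, momenta]; module
  have hu : energyScale m z.1 z.2 • z.2 = a.1 + a.2 := by
    rw [ha, momenta]; module
  have h1 : ‖a.1‖ ≤ ‖a‖ := norm_fst_le a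
  have h2 : ‖a.2‖ ≤ ‖a‖ := norm_snd_le a
  have hs := two_mul_le_energyScale m z.1 z.2
  have hz1 : ‖z.1‖ ≤ 2 * ‖a‖ := by
    rw [hk]; linarith [norm_sub_le a.1 a.2]
  have hz2 : ‖z.2‖ ≤ m⁻¹ * ‖a‖ := by
    have h3 : energyScale m z.1 z.2 * ‖z.2‖ ≤ 2 * ‖a‖ := by
      rw [← abs_of_nonneg (show 0 ≤ energyScale m z.1 z.2 by linarith), ← Real.norm_eq_abs,
        ← norm_smul, hu]
      linarith [norm_add_le a.1 a.2]
    rw [inv_mul_eq_div, le_div_iff₀ hm]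
    nlinarith [norm_nonneg z.2]
  have hi : 0 < m⁻¹ := by positivity
  rw [Prod.norm_def, pow_one]
  refine max_le ?_ ?_ <;> nlinarith [norm_nonneg a]

/-- The amplitude of the oscillatory integral in the coordinates `(k, u)`, up to a power
of `1 + ‖u‖²`, as a Schwartz function. -/
def amplitude {m : ℝ} (hm : 0 < m) (f : SchwartzMap (V3 × V3) ℂ) (M : ℕ) :
    SchwartzMap (V3 × V3) ℂ :=
  SchwartzMap.smulLeftCLM ℂ
    (fun z ↦ (1 + ‖z.2‖ ^ 2) ^ (M + 3 / 2 : ℝ) * (m ^ 2 / 2 * energyScale m z.1 z.2))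
    (SchwartzMap.compCLM ℂ (hasTemperateGrowth_momenta hm)
      ⟨1, 2 + m⁻¹, norm_le_momenta hm⟩ f)

lemma amplitude_apply {m : ℝ} (hm : 0 < m) (f : SchwartzMap (V3 × V3) ℂ) (M : ℕ) (z : V3 × V3) :
    amplitude hm f M z =
      ((1 + ‖z.2‖ ^ 2) ^ (M + 3 / 2 : ℝ) * (m ^ 2 / 2 * energyScale m z.1 z.2) : ℝ) *
        f (momenta m z) := by
  rw [amplitude, SchwartzMap.smulLeftCLM_apply_apply]
  · simp
  · exact (hasTemperateGrowth_one_add_snd_sq_rpow _).fun_mul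
      ((Function.HasTemperateGrowth.const _).fun_mul (hasTemperateGrowth_energyScale hm))

section PartialFourier

open FourierTransform LineDeriv

/-- The restriction of a Schwartz function of `(k, u)` to fixed `u`. -/
def slice (T : SchwartzMap (V3 × V3) ℂ) (u : V3) : SchwartzMap V3 ℂ :=
  SchwartzMap.compCLM ℂ (g := fun k ↦ (k, u))
    (by
      convert (ContinuousLinearMap.inl ℝ V3 V3).hasTemperateGrowth.fun_add
        (.const ((0 : V3), u)) using 2 with k
      simp)
    ⟨1, 1, fun k ↦ by
      have := norm_fst_le (k, u)
      simp only at this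
      linarith⟩ T

@[simp]
lemma slice_apply (T : SchwartzMap (V3 × V3) ℂ) (u k : V3) : slice T u k = T (k, u) := rfl

lemma exists_norm_le_one_add_norm_fst {F : Type*} [NormedAddCommGroup F] [NormedSpace ℝ F]
    (T : SchwartzMap (V3 × V3) F) :
    ∃ C, ∀ k u, ‖T (k, u)‖ ≤ C * (1 + ‖k‖) ^ (-(4 : ℝ)) := by
  refine ⟨2 ^ 4 * ((Finset.Iic (4, 0)).sup fun m ↦ SchwartzMap.seminorm ℝ m.1 m.2) T,
    fun k u ↦ ?_⟩
  have h := SchwartzMap.one_add_le_sup_seminorm_apply (𝕜 := ℝ) (m := (4, 0)) le_rfl le_rfl T (k, u)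
  rw [norm_iteratedFDeriv_zero] at h
  rw [Real.rpow_neg (by positivity), ← div_eq_mul_inv, le_div_iff₀ (by positivity)]
  refine le_trans ?_ h
  rw [mul_comm, show (4 : ℝ) = (4 : ℕ) by norm_num, Real.rpow_natCast]
  gcongr
  exact norm_fst_le (k, u)

lemma exists_norm_sub_le_one_add_norm_fst (T : SchwartzMap (V3 × V3) ℂ) :
    ∃ C, ∀ k u u', ‖T (k, u) - T (k, u')‖ ≤ C * (1 + ‖k‖) ^ (-(4 : ℝ)) * ‖u - u'‖ := by
  obtain ⟨C, hC⟩ := exists_norm_le_one_add_norm_fst (SchwartzMap.fderivCLM ℝ (V3 × V3) ℂ T)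
  refine ⟨C, fun k u u' ↦ ?_⟩
  have hd (w : V3) : HasFDerivWithinAt (fun w ↦ T (k, w))
      ((fderiv ℝ T (k, w)).comp (.inr ℝ V3 V3)) Set.univ w :=
    ((T.hasFDerivAt (k, w)).comp w (hasFDerivAt_prodMk_right k w)).hasFDerivWithinAt
  refine convex_univ.norm_image_sub_le_of_norm_hasFDerivWithin_le (fun w _ ↦ hd w) (fun w _ ↦ ?_)
    (Set.mem_univ u') (Set.mem_univ u)
  calc _ ≤ ‖fderiv ℝ T (k, w)‖ * ‖ContinuousLinearMap.inr ℝ V3 V3‖ :=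
        ContinuousLinearMap.opNorm_comp_le _ _
    _ ≤ ‖fderiv ℝ T (k, w)‖ * 1 := by
        gcongr
        exact ContinuousLinearMap.norm_inr_le_one ℝ V3 V3
    _ ≤ _ := by simpa using hC k w

lemma integrable_one_add_norm_rpow_neg_four :
    Integrable (fun k : V3 ↦ (1 + ‖k‖) ^ (-(4 : ℝ))) :=
  integrable_one_add_norm (by simp; norm_num)

lemma norm_fourier_le_integral (φ : SchwartzMap V3 ℂ) (y : V3) : ‖𝓕 φ y‖ ≤ ∫ k, ‖φ k‖ := by
  rw [SchwartzMap.fourier_coe]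
  exact VectorFourier.norm_fourierIntegral_le_integral_norm _ _ _ _ _

lemma norm_fourier_le_of_norm_le {φ : SchwartzMap V3 ℂ} {C : ℝ}
    (h : ∀ k, ‖φ k‖ ≤ C * (1 + ‖k‖) ^ (-(4 : ℝ))) (y : V3) :
    ‖𝓕 φ y‖ ≤ C * ∫ k : V3, (1 + ‖k‖) ^ (-(4 : ℝ)) := by
  rw [← integral_const_mul]
  exact (norm_fourier_le_integral φ y).trans
    (integral_mono φ.integrable.norm (integrable_one_add_norm_rpow_neg_four.const_mul C) h)

lemma slice_lineDerivOp (T : SchwartzMap (V3 × V3) ℂ) (e u : V3) :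
    slice (∂_{(e, (0 : V3))} T) u = ∂_{e} (slice T u) := by
  ext k
  rw [slice_apply, SchwartzMap.lineDerivOp_apply_eq_fderiv, SchwartzMap.lineDerivOp_apply_eq_fderiv]
  have h : HasFDerivAt (slice T u) ((fderiv ℝ T (k, u)).comp (.inl ℝ V3 V3)) k :=
    HasFDerivAt.comp (g := T) (f := fun k ↦ (k, u)) k (T.hasFDerivAt (k, u))
      (hasFDerivAt_prodMk_left k u)
  simp [h.fderiv]

lemma fourier_slice_lineDerivOp (T : SchwartzMap (V3 × V3) ℂ) (e u y : V3) :
    𝓕 (slice (∂_{(e, (0 : V3))} T) u) y = 2 * π * Complex.I * (⟪y, e⟫_ℝ * 𝓕 (slice T u) y) := by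
  have : (inner ℝ · e : V3 → ℝ).HasTemperateGrowth := by fun_prop
  rw [slice_lineDerivOp, SchwartzMap.fourier_lineDerivOp_eq]
  simp [SchwartzMap.smulLeftCLM_apply_apply this]

lemma norm_le_sum_abs_inner (y : V3) :
    ‖y‖ ≤ ∑ i : Fin 3, |⟪y, EuclideanSpace.single i (1 : ℝ)⟫_ℝ| := by
  have h : y = ∑ i : Fin 3, ⟪y, EuclideanSpace.single i (1 : ℝ)⟫_ℝ •
      EuclideanSpace.single i (1 : ℝ) := by
    ext j
    simp [EuclideanSpace.inner_single_right, Finset.sum_apply, Pi.single_apply]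
  conv_lhs => rw [h]
  refine (norm_sum_le _ _).trans (Finset.sum_le_sum fun i _ ↦ ?_)
  simp [norm_smul]

/-- The partial Fourier transform of a Schwartz function decays rapidly, and is Lipschitz in the
remaining variable with rapidly decaying constant. -/
lemma exists_norm_pow_mul_fourier_slice_le (N : ℕ) (T : SchwartzMap (V3 × V3) ℂ) :
    ∃ C, ∀ y u u', ‖y‖ ^ N * ‖𝓕 (slice T u) y‖ ≤ C ∧
      ‖y‖ ^ N * ‖𝓕 (slice T u) y - 𝓕 (slice T u') y‖ ≤ C * ‖u - u'‖ := by
  induction N generalizing T with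
  | zero =>
    obtain ⟨C₁, h₁⟩ := exists_norm_le_one_add_norm_fst T
    obtain ⟨C₂, h₂⟩ := exists_norm_sub_le_one_add_norm_fst T
    set J := ∫ k : V3, (1 + ‖k‖) ^ (-(4 : ℝ))
    refine ⟨max (C₁ * J) (C₂ * J), fun y u u' ↦ ⟨?_, ?_⟩⟩
    · rw [pow_zero, one_mul]
      exact (norm_fourier_le_of_norm_le (h₁ · u) y).trans (le_max_left _ _)
    · have h : 𝓕 (slice T u) y - 𝓕 (slice T u') y = 𝓕 (slice T u - slice T u') y := by
        rw [sub_eq_add_neg (slice T u), FourierTransform.fourier_add, FourierTransform.fourier_neg,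
          add_apply, neg_apply, sub_eq_add_neg]
      have h₃ : ‖𝓕 (slice T u - slice T u') y‖ ≤ C₂ * ‖u - u'‖ * J :=
        norm_fourier_le_of_norm_le (fun k ↦ by
          rw [sub_apply, slice_apply, slice_apply]
          linarith [h₂ k u u']) y
      rw [pow_zero, one_mul, h]
      calc _ ≤ (C₂ * J) * ‖u - u'‖ := by linarith
        _ ≤ _ := by
          gcongr
          exact le_max_right _ _
  | succ N ih =>
    choose C hC using fun i : Fin 3 ↦ ih (∂_{(EuclideanSpace.single i (1 : ℝ), (0 : V3))} T)
    have key (y : V3) (F : ℂ) (B : Fin 3 → ℝ)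
        (h : ∀ i, ‖y‖ ^ N * ‖2 * π * Complex.I *
          (⟪y, EuclideanSpace.single i (1 : ℝ)⟫_ℝ * F)‖ ≤ B i) :
        ‖y‖ ^ (N + 1) * ‖F‖ ≤ ∑ i, B i := by
      calc ‖y‖ ^ (N + 1) * ‖F‖ = ‖y‖ ^ N * (‖y‖ * ‖F‖) := by ring
        _ ≤ ‖y‖ ^ N * ((∑ i : Fin 3, |⟪y, EuclideanSpace.single i (1 : ℝ)⟫_ℝ|) * ‖F‖) := by
          gcongr
          exact norm_le_sum_abs_inner y
        _ = ∑ i : Fin 3, ‖y‖ ^ N * (|⟪y, EuclideanSpace.single i (1 : ℝ)⟫_ℝ| * ‖F‖) := by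
          rw [Finset.sum_mul, Finset.mul_sum]
        _ ≤ ∑ i, B i := by
          refine Finset.sum_le_sum fun i _ ↦ le_trans ?_ (h i)
          gcongr
          rw [norm_mul, norm_mul (⟪y, _⟫_ℝ : ℂ), Complex.norm_real, Real.norm_eq_abs]
          refine le_mul_of_one_le_left (by positivity) ?_
          simp only [norm_mul, Complex.norm_ofNat, Complex.norm_real, Complex.norm_I, mul_one,
            Real.norm_eq_abs, abs_of_pos pi_pos]
          linarith [pi_gt_three]
    refine ⟨∑ i, C i, fun y u u' ↦ ⟨key y _ _ fun i ↦ ?_, ?_⟩⟩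
    · rw [← fourier_slice_lineDerivOp]
      exact (hC i y u u').1
    · rw [Finset.sum_mul]
      refine key y _ _ fun i ↦ ?_
      rw [mul_sub, mul_sub, ← fourier_slice_lineDerivOp, ← fourier_slice_lineDerivOp]
      exact (hC i y u u').2

lemma exists_norm_fourier_slice_le (N : ℕ) (T : SchwartzMap (V3 × V3) ℂ) :
    ∃ C, ∀ y u u', ‖𝓕 (slice T u) y‖ * (1 + ‖y‖) ^ N ≤ C ∧
      ‖𝓕 (slice T u) y - 𝓕 (slice T u') y‖ * (1 + ‖y‖) ^ N ≤ C * ‖u - u'‖ := by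
  obtain ⟨C₁, h₁⟩ := exists_norm_pow_mul_fourier_slice_le 0 T
  obtain ⟨C₂, h₂⟩ := exists_norm_pow_mul_fourier_slice_le N T
  simp only [pow_zero, one_mul] at h₁
  have key (y : V3) : (1 + ‖y‖) ^ N ≤ 2 ^ N * (1 + ‖y‖ ^ N) := by
    have := add_pow_le (zero_le_one (α := ℝ)) (norm_nonneg y) N
    rw [one_pow] at this
    exact this.trans (by gcongr <;> simp)
  refine ⟨2 ^ N * (C₁ + C₂), fun y u u' ↦ ⟨?_, ?_⟩⟩
  · calc _ ≤ ‖𝓕 (slice T u) y‖ * (2 ^ N * (1 + ‖y‖ ^ N)) := by gcongr; exact key y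
      _ = 2 ^ N * (‖𝓕 (slice T u) y‖ + ‖y‖ ^ N * ‖𝓕 (slice T u) y‖) := by ring
      _ ≤ _ := by
        gcongr
        exacts [(h₁ y u u').1, (h₂ y u u').1]
  · calc _ ≤ ‖𝓕 (slice T u) y - 𝓕 (slice T u') y‖ * (2 ^ N * (1 + ‖y‖ ^ N)) := by
          gcongr; exact key y
      _ = 2 ^ N * (‖𝓕 (slice T u) y - 𝓕 (slice T u') y‖ +
          ‖y‖ ^ N * ‖𝓕 (slice T u) y - 𝓕 (slice T u') y‖) := by ring
      _ ≤ 2 ^ N * (C₁ * ‖u - u'‖ + C₂ * ‖u - u'‖) := by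
        refine mul_le_mul_of_nonneg_left (add_le_add (h₁ y u u').2 (h₂ y u u').2) (by positivity)
      _ = _ := by ring

lemma integral_fourier_slice (T : SchwartzMap (V3 × V3) ℂ) (u : V3) :
    ∫ y, 𝓕 (slice T u) y = T (0, u) := by
  have h : 𝓕⁻ (𝓕 (slice T u)) = slice T u := FourierTransform.fourierInv_fourier_eq _
  have h0 : 𝓕⁻ (𝓕 (slice T u)) 0 = T (0, u) := by rw [h, slice_apply]
  rw [← h0, SchwartzMap.fourierInv_coe, Real.fourierInv_eq]
  simp

end PartialFourier

/-- The spatial part of the four-velocity of a particle moving with velocity `v`. -/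
def properVelocity (v : V3) : V3 := (√(1 - ‖v‖ ^ 2))⁻¹ • v

/-- The total energy `ω(p) + ω(q)` as a function of `k = p - q` and
`v = (p + q) / (ω(p) + ω(q))`. -/
def pairEnergy (m : ℝ) (k v : V3) : ℝ :=
  √((4 * m ^ 2 + ‖k‖ ^ 2 - ⟪k, v⟫_ℝ ^ 2) / (1 - ‖v‖ ^ 2))

/-- The momentum `p` as a function of `k = p - q` and `v = (p + q) / (ω(p) + ω(q))`. -/
def leftMomentum (m : ℝ) (k v : V3) : V3 := (1 / 2 : ℝ) • (pairEnergy m k v • v + k)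

section Kinematics

variable {m : ℝ} {k v : V3}

lemma one_sub_norm_sq_pos (hv : ‖v‖ < 1) : 0 < 1 - ‖v‖ ^ 2 := by
  nlinarith [norm_nonneg v]

lemma pairEnergy_numerator_pos (hm : 0 < m) (hv : ‖v‖ < 1) :
    0 < 4 * m ^ 2 + ‖k‖ ^ 2 - ⟪k, v⟫_ℝ ^ 2 := by
  nlinarith [inner_sq_le_norm_sq_mul k v, one_sub_norm_sq_pos hv, sq_nonneg ‖k‖, sq_pos_of_pos hm]

lemma pairEnergy_pos (hm : 0 < m) (hv : ‖v‖ < 1) : 0 < pairEnergy m k v :=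
  Real.sqrt_pos.2 (div_pos (pairEnergy_numerator_pos hm hv) (one_sub_norm_sq_pos hv))

lemma pairEnergy_sq_mul (hm : 0 < m) (hv : ‖v‖ < 1) :
    pairEnergy m k v ^ 2 * (1 - ‖v‖ ^ 2) = 4 * m ^ 2 + ‖k‖ ^ 2 - ⟪k, v⟫_ℝ ^ 2 := by
  have h := one_sub_norm_sq_pos hv
  rw [pairEnergy, Real.sq_sqrt (div_pos (pairEnergy_numerator_pos hm hv) h).le]
  field_simp

lemma abs_inner_le_pairEnergy (hm : 0 < m) (hv : ‖v‖ < 1) :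
    |⟪k, v⟫_ℝ| ≤ pairEnergy m k v := by
  apply abs_le_of_sq_le_sq _ (pairEnergy_pos hm hv).le
  have h := one_sub_norm_sq_pos hv
  have h1 := pairEnergy_sq_mul (k := k) hm hv
  have h2 := inner_sq_le_norm_sq_mul k v
  refine le_of_mul_le_mul_right ?_ h
  nlinarith [sq_nonneg ‖k‖, sq_nonneg ‖v‖, sq_pos_of_pos hm,
    mul_nonneg (sq_nonneg ‖k‖) (sq_nonneg (1 - ‖v‖ ^ 2))]

lemma leftMomentum_sub (m : ℝ) (k v : V3) :
    leftMomentum m k v - k = (1 / 2 : ℝ) • (pairEnergy m k v • v - k) := by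
  rw [leftMomentum]; module

lemma ωm_leftMomentum (hm : 0 < m) (hv : ‖v‖ < 1) :
    ωm m (leftMomentum m k v) = (pairEnergy m k v + ⟪k, v⟫_ℝ) / 2 := by
  have h := abs_le.1 (abs_inner_le_pairEnergy (k := k) hm hv)
  rw [ωm, leftMomentum, Real.sqrt_eq_iff_mul_self_eq (by positivity) (by linarith), norm_smul,
    mul_pow, norm_add_sq_real, norm_smul, inner_smul_left, real_inner_comm]
  have h1 := pairEnergy_sq_mul (k := k) hm hv
  simp only [Real.norm_eq_abs, mul_pow, sq_abs, conj_trivial]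
  linarith

lemma ωm_leftMomentum_sub (hm : 0 < m) (hv : ‖v‖ < 1) :
    ωm m (leftMomentum m k v - k) = (pairEnergy m k v - ⟪k, v⟫_ℝ) / 2 := by
  have h := abs_le.1 (abs_inner_le_pairEnergy (k := k) hm hv)
  rw [leftMomentum_sub, ωm, Real.sqrt_eq_iff_mul_self_eq (by positivity) (by linarith), norm_smul,
    mul_pow, norm_sub_sq_real, norm_smul, inner_smul_left, real_inner_comm]
  have h1 := pairEnergy_sq_mul (k := k) hm hv
  simp only [Real.norm_eq_abs, mul_pow, sq_abs, conj_trivial]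
  linarith

lemma ωm_pos (hm : 0 < m) (p : V3) : 0 < ωm m p := Real.sqrt_pos.2 (by positivity)

lemma ωm_sq (m : ℝ) (p : V3) : ωm m p ^ 2 = m ^ 2 + ‖p‖ ^ 2 := Real.sq_sqrt (by positivity)

lemma norm_lt_ωm (hm : 0 < m) (p : V3) : ‖p‖ < ωm m p :=
  Real.lt_sqrt_of_sq_lt (by linarith [sq_pos_of_pos hm])

lemma injOn_leftMomentum (hm : 0 < m) (k : V3) :
    Set.InjOn (leftMomentum m k) (Metric.ball 0 1) := by
  intro v hv v' hv' h
  rw [mem_ball_zero_iff] at hv hv'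
  have hE : pairEnergy m k v = pairEnergy m k v' := by
    have h1 := ωm_leftMomentum (k := k) hm hv
    have h2 := ωm_leftMomentum_sub (k := k) hm hv
    have h3 := ωm_leftMomentum (k := k) hm hv'
    have h4 := ωm_leftMomentum_sub (k := k) hm hv'
    rw [h] at h1 h2
    linarith
  have h5 : pairEnergy m k v • v = pairEnergy m k v • v' := by
    have : ∀ w, pairEnergy m k w • w = (2 : ℝ) • leftMomentum m k w - k := fun w ↦ by
      rw [leftMomentum]; module
    rw [this v, h, ← this v', hE]
  exact smul_right_injective V3 (pairEnergy_pos hm hv).ne' h5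

lemma image_leftMomentum (hm : 0 < m) (k : V3) :
    Set.image (leftMomentum m k) (Metric.ball 0 1) = Set.univ := by
  refine Set.eq_univ_of_forall fun p ↦ ?_
  obtain ⟨q, rfl⟩ : ∃ q, k = p - q := ⟨p - k, by abel⟩
  have hp := ωm_pos hm p
  have hq := ωm_pos hm q
  have hE : 0 < ωm m p + ωm m q := by positivity
  set E := ωm m p + ωm m q
  have hnorm : ‖E⁻¹ • (p + q)‖ < 1 := by
    rw [norm_smul, norm_inv, Real.norm_of_nonneg hE.le, inv_mul_lt_one₀ hE]
    exact (norm_add_le p q).trans_lt (add_lt_add (norm_lt_ωm hm p) (norm_lt_ωm hm q))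
  have hinner : ⟪p - q, E⁻¹ • (p + q)⟫_ℝ = ωm m p - ωm m q := by
    rw [inner_smul_right, inner_sub_left, inner_add_right, inner_add_right, real_inner_comm q p,
      real_inner_self_eq_norm_sq, real_inner_self_eq_norm_sq, inv_mul_eq_iff_eq_mul₀ hE.ne']
    linarith [ωm_sq m p, ωm_sq m q]
  have henergy : pairEnergy m (p - q) (E⁻¹ • (p + q)) = E := by
    rw [pairEnergy, Real.sqrt_eq_iff_mul_self_eq_of_pos hE,
      eq_div_iff (one_sub_norm_sq_pos hnorm).ne', hinner, norm_smul, norm_inv,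
      Real.norm_of_nonneg hE.le, norm_sub_sq_real, mul_pow, norm_add_sq_real]
    field_simp
    linarith [ωm_sq m p, ωm_sq m q]
  refine ⟨E⁻¹ • (p + q), mem_ball_zero_iff.2 hnorm, ?_⟩
  rw [leftMomentum, henergy, smul_inv_smul₀ hE.ne']
  module

/-- The derivative of `pairEnergy m k`. -/
def pairEnergyFDeriv (m : ℝ) (k v : V3) : V3 →L[ℝ] ℝ :=
  (pairEnergy m k v * (1 - ‖v‖ ^ 2) ^ 2)⁻¹ •
    ((4 * m ^ 2 + ‖k‖ ^ 2 - ⟪k, v⟫_ℝ ^ 2) • innerSL ℝ v -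
      ((1 - ‖v‖ ^ 2) * ⟪k, v⟫_ℝ) • innerSL ℝ k)

lemma hasFDerivAt_pairEnergy (hm : 0 < m) (hv : ‖v‖ < 1) :
    HasFDerivAt (pairEnergy m k) (pairEnergyFDeriv m k v) v := by
  have hB := one_sub_norm_sq_pos hv
  have hk : HasFDerivAt (fun v : V3 ↦ ⟪k, v⟫_ℝ) (innerSL ℝ k) v := (innerSL ℝ k).hasFDerivAt
  have hA : HasFDerivAt (fun v : V3 ↦ 4 * m ^ 2 + ‖k‖ ^ 2 - ⟪k, v⟫_ℝ ^ 2)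
      (-((2 * ⟪k, v⟫_ℝ) • innerSL ℝ k)) v := by
    simpa using (hk.pow 2).const_sub (4 * m ^ 2 + ‖k‖ ^ 2)
  have hN : HasFDerivAt (fun v : V3 ↦ 1 - ‖v‖ ^ 2) (-((2 : ℝ) • innerSL ℝ v)) v := by
    simpa [ofNat_smul_eq_nsmul] using (hasStrictFDerivAt_norm_sq v).hasFDerivAt.const_sub 1
  have hQ := (hA.mul ((hasDerivAt_inv hB.ne').comp_hasFDerivAt v hN)).sqrt
    (mul_pos (pairEnergy_numerator_pos hm hv) (inv_pos.2 hB)).ne'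
  have hE := pairEnergy_pos (k := k) hm hv
  refine hQ.congr_fderiv ?_
  ext w
  change _ = pairEnergyFDeriv m k v w
  have hE' : √((4 * m ^ 2 + ‖k‖ ^ 2 - ⟪k, v⟫_ℝ ^ 2) / (1 - ‖v‖ ^ 2)) = pairEnergy m k v := rfl
  simp [pairEnergyFDeriv, ← div_eq_mul_inv, hE']
  field_simp
  ring

/-- The derivative of `leftMomentum m k`. -/
def leftMomentumFDeriv (m : ℝ) (k v : V3) : V3 →L[ℝ] V3 :=
  (1 / 2 : ℝ) • (pairEnergy m k v • ContinuousLinearMap.id ℝ V3 +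
    (pairEnergyFDeriv m k v).smulRight v)

lemma hasFDerivAt_leftMomentum (hm : 0 < m) (hv : ‖v‖ < 1) :
    HasFDerivAt (leftMomentum m k) (leftMomentumFDeriv m k v) v :=
  (((hasFDerivAt_pairEnergy hm hv).smul (hasFDerivAt_id v)).add_const k).const_smul (1 / 2 : ℝ)

lemma det_leftMomentumFDeriv (hm : 0 < m) (hv : ‖v‖ < 1) :
    (leftMomentumFDeriv m k v).det = pairEnergy m k v / (2 * (1 - ‖v‖ ^ 2)) *
      (ωm m (leftMomentum m k v) * ωm m (leftMomentum m k v - k)) := by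
  have hE := pairEnergy_pos (k := k) hm hv
  have hB := one_sub_norm_sq_pos hv
  set E := pairEnergy m k v with hEdef
  have hmap : (leftMomentumFDeriv m k v : V3 →ₗ[ℝ] V3) =
      (E / 2) • LinearMap.transvection (E⁻¹ • (pairEnergyFDeriv m k v : V3 →ₗ[ℝ] ℝ)) v := by
    ext1 w
    simp only [leftMomentumFDeriv, ContinuousLinearMap.coe_coe, LinearMap.smul_apply,
      LinearMap.transvection.apply, smul_apply, add_apply,
      ContinuousLinearMap.smulRight_apply, ContinuousLinearMap.id_apply, smul_eq_mul, smul_add,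
      smul_smul, ← hEdef]
    congr 2
    · ring
    · field_simp
  rw [ContinuousLinearMap.det, hmap, LinearMap.det_smul, LinearMap.transvection.det,
    ωm_leftMomentum hm hv, ωm_leftMomentum_sub hm hv, ← hEdef]
  have h1 := pairEnergy_sq_mul (k := k) hm hv
  rw [← hEdef] at h1
  simp [pairEnergyFDeriv, ← hEdef, ← h1]
  field_simp
  ring

lemma integral_eq_integral_ball_leftMomentum (hm : 0 < m) (k : V3) (g : V3 → ℂ) :
    ∫ p, g p = ∫ v in Metric.ball (0 : V3) 1,
      (pairEnergy m k v / (2 * (1 - ‖v‖ ^ 2)) *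
        (ωm m (leftMomentum m k v) * ωm m (leftMomentum m k v - k))) •
          g (leftMomentum m k v) := by
  rw [← setIntegral_univ, ← image_leftMomentum hm k,
    integral_image_eq_integral_abs_det_fderiv_smul volume measurableSet_ball
      (fun v hv ↦ (hasFDerivAt_leftMomentum hm (mem_ball_zero_iff.1 hv)).hasFDerivWithinAt)
      (injOn_leftMomentum hm k)]
  refine setIntegral_congr_fun measurableSet_ball fun v hv ↦ ?_
  rw [mem_ball_zero_iff] at hv
  have hB := one_sub_norm_sq_pos hv
  have hE := pairEnergy_pos (k := k) hm hv
  have hp := ωm_pos hm (leftMomentum m k v)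
  have hq := ωm_pos hm (leftMomentum m k v - k)
  simp only [det_leftMomentumFDeriv hm hv]
  rw [abs_of_pos (by positivity)]

lemma one_add_norm_properVelocity_sq (hv : ‖v‖ < 1) :
    1 + ‖properVelocity v‖ ^ 2 = (1 - ‖v‖ ^ 2)⁻¹ := by
  have hB := one_sub_norm_sq_pos hv
  rw [properVelocity, norm_smul, mul_pow, norm_inv, Real.norm_of_nonneg (Real.sqrt_nonneg _),
    inv_pow, Real.sq_sqrt hB.le]
  field_simp
  ring

lemma pairEnergy_eq_energyScale_mul (hv : ‖v‖ < 1) :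
    pairEnergy m k v = energyScale m k (properVelocity v) * (√(1 - ‖v‖ ^ 2))⁻¹ := by
  have hB := one_sub_norm_sq_pos hv
  rw [energyScale, one_add_norm_properVelocity_sq hv, pairEnergy, Real.sqrt_div' _ hB.le,
    ← div_eq_mul_inv, properVelocity, inner_smul_right, mul_pow, inv_pow, Real.sq_sqrt hB.le,
    inv_mul_eq_div, div_inv_eq_mul, div_mul_cancel₀ _ hB.ne']

lemma momenta_properVelocity (hv : ‖v‖ < 1) :
    momenta m (k, properVelocity v) = (leftMomentum m k v, leftMomentum m k v - k) := by
  have h : energyScale m k (properVelocity v) • properVelocity v = pairEnergy m k v • v := by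
    rw [pairEnergy_eq_energyScale_mul hv, mul_smul, ← properVelocity]
  rw [momenta, leftMomentum_sub, h, leftMomentum]

end Kinematics

section Representation

variable {m : ℝ}

lemma continuous_ωm (m : ℝ) : Continuous (ωm m) := by
  unfold ωm
  fun_prop

lemma le_ωm (m : ℝ) (p : V3) : m ≤ ωm m p :=
  Real.le_sqrt_of_sq_le (by linarith [sq_nonneg ‖p‖])

/-- The integrand of `Iminus`. -/
def pairIntegrand (m : ℝ) (f : SchwartzMap (V3 × V3) ℂ) (x0 : ℝ) (xv p q : V3) : ℂ :=
  f (p, q) *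
    Complex.exp (-Complex.I *
      (((ωm m p - ωm m q) * x0 - (⟪p, xv⟫_ℝ - ⟪q, xv⟫_ℝ) : ℝ) : ℂ)) *
    (((m ^ 2 / (ωm m p * ωm m q) : ℝ)) : ℂ)

lemma norm_exp_neg_I_mul (t : ℝ) : ‖Complex.exp (-Complex.I * (t : ℂ))‖ = 1 := by
  rw [show -Complex.I * (t : ℂ) = ((-t : ℝ) : ℂ) * Complex.I by push_cast; ring,
    Complex.norm_exp_ofReal_mul_I]

lemma integrable_pairIntegrand (hm : 0 < m) (f : SchwartzMap (V3 × V3) ℂ) (x0 : ℝ) (xv : V3) :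
    Integrable (Function.uncurry (pairIntegrand m f x0 xv)) (volume.prod volume) := by
  have hc := continuous_ωm m
  have : (volume.prod volume : Measure (V3 × V3)).HasTemperateGrowth :=
    Measure.IsAddHaarMeasure.instHasTemperateGrowth
  have hf : Integrable (fun z : V3 × V3 ↦ f z) (volume.prod volume) := f.integrable
  refine (hf.mul_bdd (c := 1) ?_ ?_).mul_bdd (c := 1) ?_ ?_
  · exact Continuous.aestronglyMeasurable (by fun_prop)
  · exact .of_forall fun z ↦ (norm_exp_neg_I_mul _).le
  · refine Continuous.aestronglyMeasurable (Complex.continuous_ofReal.comp ?_)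
    refine continuous_const.div (by fun_prop) fun z ↦ ?_
    exact (mul_pos (ωm_pos hm z.1) (ωm_pos hm z.2)).ne'
  · refine .of_forall fun z ↦ ?_
    have h1 := ωm_pos hm z.1
    have h2 := ωm_pos hm z.2
    rw [Complex.norm_real, Real.norm_of_nonneg (by positivity), div_le_one (by positivity), sq]
    exact mul_le_mul (le_ωm m _) (le_ωm m _) hm.le h1.le

lemma integral_pairIntegrand_eq (hm : 0 < m) (f : SchwartzMap (V3 × V3) ℂ) (x0 : ℝ) (xv : V3) :
    ∫ p, ∫ q, pairIntegrand m f x0 xv p q = ∫ k, ∫ p, pairIntegrand m f x0 xv p (p - k) := by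
  have hshear : MeasurePreserving (fun z : V3 × V3 ↦ (z.1, z.1 - z.2))
      (volume.prod volume) (volume.prod volume) := by
    have h := ((MeasurePreserving.id volume).prod (Measure.measurePreserving_neg volume)).comp
      (measurePreserving_prod_sub (volume : Measure V3) volume)
    rwa [show Prod.map id Neg.neg ∘ (fun z : V3 × V3 ↦ (z.1, z.2 - z.1)) =
      fun z ↦ (z.1, z.1 - z.2) by ext1 z; simp] at h
  rw [integral_integral_swap (f := fun k p ↦ pairIntegrand m f x0 xv p (p - k))]
  · exact integral_congr_ae (.of_forall fun p ↦
      (integral_sub_left_eq_self (pairIntegrand m f x0 xv p) volume p).symm)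
  · rw [← integrable_swap_iff]
    exact hshear.integrable_comp_of_integrable (integrable_pairIntegrand hm f x0 xv)

lemma pairIntegrand_leftMomentum (hm : 0 < m) (f : SchwartzMap (V3 × V3) ℂ) (M : ℕ) (x0 : ℝ)
    (xv k : V3) {v : V3} (hv : ‖v‖ < 1) :
    (pairEnergy m k v / (2 * (1 - ‖v‖ ^ 2)) *
      (ωm m (leftMomentum m k v) * ωm m (leftMomentum m k v - k))) •
        pairIntegrand m f x0 xv (leftMomentum m k v) (leftMomentum m k v - k) =
      (((1 - ‖v‖ ^ 2) ^ M : ℝ) : ℂ) * (Complex.exp (-Complex.I * (⟪k, x0 • v - xv⟫_ℝ : ℝ)) *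
        amplitude hm f M (k, properVelocity v)) := by
  have hB := one_sub_norm_sq_pos hv
  have hp := ωm_pos hm (leftMomentum m k v)
  have hq := ωm_pos hm (leftMomentum m k v - k)
  have hphase : (ωm m (leftMomentum m k v) - ωm m (leftMomentum m k v - k)) * x0 -
      (⟪leftMomentum m k v, xv⟫_ℝ - ⟪leftMomentum m k v - k, xv⟫_ℝ) = ⟪k, x0 • v - xv⟫_ℝ := by
    rw [ωm_leftMomentum hm hv, ωm_leftMomentum_sub hm hv, inner_sub_left, inner_sub_right,
      inner_smul_right]
    ring
  have hweight : pairEnergy m k v / (2 * (1 - ‖v‖ ^ 2)) *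
      (ωm m (leftMomentum m k v) * ωm m (leftMomentum m k v - k)) *
        (m ^ 2 / (ωm m (leftMomentum m k v) * ωm m (leftMomentum m k v - k))) =
      (1 - ‖v‖ ^ 2) ^ M * ((1 + ‖properVelocity v‖ ^ 2) ^ (M + 3 / 2 : ℝ) *
        (m ^ 2 / 2 * energyScale m k (properVelocity v))) := by
    rw [one_add_norm_properVelocity_sq hv, pairEnergy_eq_energyScale_mul hv,
      Real.rpow_add (by positivity), Real.rpow_natCast, inv_pow,
      show (3 / 2 : ℝ) = 1 + 1 / 2 by norm_num, Real.rpow_add (by positivity), Real.rpow_one,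
      ← Real.sqrt_eq_rpow, Real.sqrt_inv]
    field_simp
  rw [pairIntegrand, hphase, amplitude_apply, momenta_properVelocity hv, Complex.real_smul]
  calc _ = ((pairEnergy m k v / (2 * (1 - ‖v‖ ^ 2)) *
      (ωm m (leftMomentum m k v) * ωm m (leftMomentum m k v - k)) *
        (m ^ 2 / (ωm m (leftMomentum m k v) * ωm m (leftMomentum m k v - k))) : ℝ) : ℂ) *
      (Complex.exp (-Complex.I * (⟪k, x0 • v - xv⟫_ℝ : ℝ)) *
        f (leftMomentum m k v, leftMomentum m k v - k)) := by push_cast; ring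
    _ = _ := by rw [hweight]; push_cast; ring

lemma measurable_properVelocity : Measurable properVelocity := by
  unfold properVelocity
  fun_prop

open FourierTransform in
lemma Iminus_eq_integral_ball (hm : 0 < m) (f : SchwartzMap (V3 × V3) ℂ) (M : ℕ) (x0 : ℝ)
    (xv : V3) :
    Iminus m f x0 xv = ((((2 * π) ^ 3)⁻¹ : ℝ) : ℂ) * ∫ v in Metric.ball (0 : V3) 1,
      (((1 - ‖v‖ ^ 2) ^ M : ℝ) : ℂ) *
        𝓕 (slice (amplitude hm f M) (properVelocity v)) ((2 * π)⁻¹ • (x0 • v - xv)) := by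
  have h1 (k : V3) : ∫ p, pairIntegrand m f x0 xv p (p - k) = ∫ v in Metric.ball (0 : V3) 1,
      (((1 - ‖v‖ ^ 2) ^ M : ℝ) : ℂ) * (Complex.exp (-Complex.I * (⟪k, x0 • v - xv⟫_ℝ : ℝ)) *
        amplitude hm f M (k, properVelocity v)) := by
    rw [integral_eq_integral_ball_leftMomentum hm k]
    exact setIntegral_congr_fun measurableSet_ball fun v hv ↦
      pairIntegrand_leftMomentum hm f M x0 xv k (mem_ball_zero_iff.1 hv)
  change _ * ∫ p, ∫ q, pairIntegrand m f x0 xv p q = _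
  simp_rw [integral_pairIntegrand_eq hm, h1]
  rw [integral_integral_swap]
  · congr 2 with v
    rw [integral_const_mul, SchwartzMap.fourier_coe, Real.fourier_eq']
    congr 2 with k
    rw [slice_apply, smul_eq_mul, inner_smul_right]
    congr 2
    push_cast
    field_simp
  · obtain ⟨C, hC⟩ := exists_norm_le_one_add_norm_fst (amplitude hm f M)
    have hintegrable : Integrable (fun z : V3 × V3 ↦ C * (1 + ‖z.1‖) ^ (-(4 : ℝ)) * 1)
        (volume.prod (volume.restrict (Metric.ball (0 : V3) 1))) := by
      have : IsFiniteMeasure (volume.restrict (Metric.ball (0 : V3) 1)) :=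
        ⟨by simp⟩
      exact (integrable_one_add_norm_rpow_neg_four.const_mul C).mul_prod (integrable_const 1)
    refine hintegrable.mono' ?_ ?_
    · refine Measurable.aestronglyMeasurable ?_
      have hT := (amplitude hm f M).continuous.measurable
      have hu := measurable_properVelocity
      refine Measurable.mul (by fun_prop) (Measurable.mul (by fun_prop) ?_)
      exact hT.comp (measurable_fst.prodMk (hu.comp measurable_snd))
    · have hmem : ∀ᵐ z ∂(volume : Measure V3).prod (volume.restrict (Metric.ball (0 : V3) 1)),
          z.2 ∈ Metric.ball (0 : V3) 1 :=
        Measure.quasiMeasurePreserving_snd.ae (ae_restrict_mem measurableSet_ball)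
      filter_upwards [hmem] with z hz
      rw [mem_ball_zero_iff] at hz
      have hB := one_sub_norm_sq_pos hz
      rw [Function.uncurry, norm_mul, norm_mul, norm_exp_neg_I_mul, one_mul, mul_one,
        Complex.norm_real, Real.norm_of_nonneg (by positivity)]
      refine (mul_le_of_le_one_left (norm_nonneg _) ?_).trans (hC _ _)
      exact pow_le_one₀ hB.le (by linarith [sq_nonneg ‖z.2‖])

end Representation

open FourierTransform in
/-- Rapid decay of `Iminus` outside the region `1 ≤ x0² - ‖xv‖²`. -/
lemma exists_norm_Iminus_le {m : ℝ} (hm : 0 < m) (f : SchwartzMap (V3 × V3) ℂ) (N : ℕ) :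
    ∃ C : ℝ, ∀ (x0 : ℝ) (xv : V3), x0 ^ 2 - ‖xv‖ ^ 2 < 1 →
      ‖Iminus m f x0 xv‖ ≤ C * (1 + Real.sqrt (x0 ^ 2 + ‖xv‖ ^ 2)) ^ (-(N : ℝ)) := by
  obtain ⟨C, hC⟩ := exists_norm_fourier_slice_le N (amplitude hm f N)
  refine ⟨((2 * π) ^ 3)⁻¹ * (32 ^ N * C * volume.real (Metric.ball (0 : V3) 1)),
    fun x0 xv hx ↦ ?_⟩
  set R := √(x0 ^ 2 + ‖xv‖ ^ 2)
  have hx0 : |x0| ≤ 1 + ‖xv‖ :=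
    abs_le_of_sq_le_sq (by nlinarith [norm_nonneg xv]) (by positivity)
  have hR0 : 0 ≤ R := Real.sqrt_nonneg _
  have hR : R ≤ 1 + 2 * ‖xv‖ := by
    refine Real.sqrt_le_iff.2 ⟨by positivity, ?_⟩
    nlinarith [norm_nonneg xv]
  have hgeom (v : V3) (hv : ‖v‖ < 1) :
      (1 - ‖v‖ ^ 2) * (1 + R) ≤ 32 * (1 + ‖(2 * π)⁻¹ • (x0 • v - xv)‖) := by
    have hy : ‖xv‖ * (1 - ‖v‖) - 1 ≤ ‖x0 • v - xv‖ := by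
      have h := norm_sub_norm_le xv (x0 • v)
      rw [norm_smul, Real.norm_eq_abs, norm_sub_rev] at h
      nlinarith [norm_nonneg v]
    have hpi : ‖x0 • v - xv‖ ≤ 8 * ‖(2 * π)⁻¹ • (x0 • v - xv)‖ := by
      rw [norm_smul, norm_inv, Real.norm_of_nonneg (by positivity), inv_mul_eq_div,
        ← mul_div_assoc, le_div_iff₀ (by positivity)]
      nlinarith [pi_le_four, norm_nonneg (x0 • v - xv)]
    have hB := one_sub_norm_sq_pos hv
    have h1 : (1 - ‖v‖ ^ 2) * ‖xv‖ ≤ 2 * (‖xv‖ * (1 - ‖v‖)) := by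
      nlinarith [norm_nonneg xv, mul_nonneg (norm_nonneg xv) (sq_nonneg (1 - ‖v‖))]
    nlinarith [sq_nonneg ‖v‖]
  have hbound (v : V3) (hv : v ∈ Metric.ball (0 : V3) 1) :
      ‖(((1 - ‖v‖ ^ 2) ^ N : ℝ) : ℂ) * 𝓕 (slice (amplitude hm f N) (properVelocity v))
        ((2 * π)⁻¹ • (x0 • v - xv))‖ ≤ 32 ^ N * C * (1 + R) ^ (-(N : ℝ)) := by
    rw [mem_ball_zero_iff] at hv
    have hB := one_sub_norm_sq_pos hv
    have h := (hC ((2 * π)⁻¹ • (x0 • v - xv)) (properVelocity v) 0).1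
    have hp := pow_le_pow_left₀ (by positivity) (hgeom v hv) N
    rw [norm_mul, Complex.norm_real, Real.norm_of_nonneg (by positivity),
      Real.rpow_neg (by positivity), Real.rpow_natCast, ← div_eq_mul_inv,
      le_div_iff₀ (by positivity)]
    rw [mul_pow, mul_pow] at hp
    set F := ‖𝓕 (slice (amplitude hm f N) (properVelocity v)) ((2 * π)⁻¹ • (x0 • v - xv))‖
    have hF : 0 ≤ F := norm_nonneg _
    calc _ = ((1 - ‖v‖ ^ 2) ^ N * (1 + R) ^ N) * F := by ring
      _ ≤ 32 ^ N * (1 + ‖(2 * π)⁻¹ • (x0 • v - xv)‖) ^ N * F := by gcongr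
      _ = 32 ^ N * (F * (1 + ‖(2 * π)⁻¹ • (x0 • v - xv)‖) ^ N) := by ring
      _ ≤ _ := by gcongr
  rw [Iminus_eq_integral_ball hm f N, norm_mul, Complex.norm_real,
    Real.norm_of_nonneg (by positivity)]
  calc _ ≤ ((2 * π) ^ 3)⁻¹ * (32 ^ N * C * (1 + R) ^ (-(N : ℝ)) *
        volume.real (Metric.ball (0 : V3) 1)) := by
        gcongr
        exact norm_setIntegral_le_of_norm_le_const measure_ball_lt_top hbound
    _ = _ := by ring

section Leading

open FourierTransform

lemma abs_norm_sq_sub_norm_sq_le {v v' : V3} (hv : ‖v‖ ≤ 1) (hv' : ‖v'‖ ≤ 1) :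
    |‖v‖ ^ 2 - ‖v'‖ ^ 2| ≤ 2 * ‖v - v'‖ := by
  rw [sq_sub_sq, abs_mul, abs_of_nonneg (by positivity)]
  exact mul_le_mul (by linarith) (abs_norm_sub_norm_le v v') (abs_nonneg _) (by norm_num)

lemma norm_properVelocity_sub_le {v v' : V3} (hv : ‖v‖ < 1) (h : ‖v'‖ ≤ ‖v‖) :
    (1 - ‖v‖ ^ 2) ^ 2 * ‖properVelocity v - properVelocity v'‖ ≤ 3 * ‖v - v'‖ := by
  have hB := one_sub_norm_sq_pos hv
  have hv' := h.trans_lt hv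
  have hB' := one_sub_norm_sq_pos hv'
  set b := √(1 - ‖v‖ ^ 2) with hb
  set b' := √(1 - ‖v'‖ ^ 2) with hb'
  have hbpos : 0 < b := Real.sqrt_pos.2 hB
  have hbpos' : 0 < b' := Real.sqrt_pos.2 hB'
  have hbsq : b ^ 2 = 1 - ‖v‖ ^ 2 := Real.sq_sqrt hB.le
  have hbsq' : b' ^ 2 = 1 - ‖v'‖ ^ 2 := Real.sq_sqrt hB'.le
  have hbb' : b ≤ b' := Real.sqrt_le_sqrt (by gcongr)
  have hb1 : b' ≤ 1 := by nlinarith [sq_nonneg ‖v'‖]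
  have hd : b' * (b' - b) ≤ 2 * ‖v - v'‖ := by
    have := (le_abs_self _).trans (abs_norm_sq_sub_norm_sq_le hv.le hv'.le)
    nlinarith
  have hu : (b * b') • (properVelocity v - properVelocity v') =
      b' • (v - v') + (b' - b) • v' := by
    rw [properVelocity, properVelocity, ← hb, ← hb', smul_sub, smul_smul, smul_smul,
      mul_comm b b', mul_inv_cancel_right₀ hbpos.ne', mul_comm b' b,
      mul_inv_cancel_right₀ hbpos'.ne']
    module
  have hn : b * b' * ‖properVelocity v - properVelocity v'‖ ≤ b' * ‖v - v'‖ + (b' - b) := by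
    rw [← Real.norm_of_nonneg (mul_pos hbpos hbpos').le, ← norm_smul, hu]
    refine (norm_add_le _ _).trans ?_
    rw [norm_smul, norm_smul, Real.norm_of_nonneg hbpos'.le, Real.norm_of_nonneg (by linarith)]
    nlinarith
  set D := ‖properVelocity v - properVelocity v'‖
  have hD : 0 ≤ D := norm_nonneg _
  have hb4 : (1 - ‖v‖ ^ 2) ^ 2 ≤ b * b' * b' := by
    rw [← hbsq]
    calc (b ^ 2) ^ 2 = b * b * (b * b) := by ring
      _ ≤ b * b' * (b' * 1) := by gcongr; exact hbb'.trans hb1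
      _ = _ := by ring
  calc (1 - ‖v‖ ^ 2) ^ 2 * D ≤ b * b' * b' * D := by gcongr
    _ = b' * (b * b' * D) := by ring
    _ ≤ b' * (b' * ‖v - v'‖ + (b' - b)) := by gcongr
    _ = b' * b' * ‖v - v'‖ + b' * (b' - b) := by ring
    _ ≤ 1 * 1 * ‖v - v'‖ + 2 * ‖v - v'‖ := by gcongr
    _ = _ := by ring

/-- The partial Fourier transform of `T`, as a function of the velocity, with a weight that vanishes
outside the unit ball. -/
def weightedFourier (T : SchwartzMap (V3 × V3) ℂ) (v y : V3) : ℂ :=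
  ((max (1 - ‖v‖ ^ 2) 0 ^ 2 : ℝ) : ℂ) * 𝓕 (slice T (properVelocity v)) y

lemma weightedFourier_of_norm_lt {T : SchwartzMap (V3 × V3) ℂ} {v : V3} (hv : ‖v‖ < 1) (y : V3) :
    weightedFourier T v y =
      (((1 - ‖v‖ ^ 2) ^ 2 : ℝ) : ℂ) * 𝓕 (slice T (properVelocity v)) y := by
  rw [weightedFourier, max_eq_left (one_sub_norm_sq_pos hv).le]

lemma weightedFourier_of_le_norm {T : SchwartzMap (V3 × V3) ℂ} {v : V3} (hv : 1 ≤ ‖v‖) (y : V3) :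
    weightedFourier T v y = 0 := by
  rw [weightedFourier, max_eq_right (by nlinarith)]
  simp

lemma exists_norm_weightedFourier_sub_le (T : SchwartzMap (V3 × V3) ℂ) :
    ∃ C, ∀ v v' y, ‖v'‖ < 1 →
      ‖weightedFourier T v y - weightedFourier T v' y‖ * (1 + ‖y‖) ^ 5 ≤ C * ‖v - v'‖ := by
  obtain ⟨C, hC⟩ := exists_norm_fourier_slice_le 5 T
  have hC0 : 0 ≤ C := le_trans (by positivity) (hC 0 0 0).1
  have inside (v v' y : V3) (hv : ‖v‖ < 1) (h : ‖v'‖ ≤ ‖v‖) :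
      ‖weightedFourier T v y - weightedFourier T v' y‖ * (1 + ‖y‖) ^ 5 ≤
        7 * C * ‖v - v'‖ := by
    have hv' := h.trans_lt hv
    have hB := one_sub_norm_sq_pos hv
    have hB' := one_sub_norm_sq_pos hv'
    obtain ⟨-, h1⟩ := hC y (properVelocity v) (properVelocity v')
    obtain ⟨h2, -⟩ := hC y (properVelocity v') 0
    have h3 := norm_properVelocity_sub_le hv h
    rw [weightedFourier_of_norm_lt hv, weightedFourier_of_norm_lt hv']
    set F := 𝓕 (slice T (properVelocity v)) y
    set F' := 𝓕 (slice T (properVelocity v')) y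
    have h4 : |(1 - ‖v‖ ^ 2) ^ 2 - (1 - ‖v'‖ ^ 2) ^ 2| ≤ 4 * ‖v - v'‖ := by
      have := abs_norm_sq_sub_norm_sq_le hv'.le hv.le
      rw [norm_sub_rev] at this
      rw [sq_sub_sq, abs_mul, show 1 - ‖v‖ ^ 2 - (1 - ‖v'‖ ^ 2) = ‖v'‖ ^ 2 - ‖v‖ ^ 2 by ring,
        abs_of_pos (by positivity)]
      nlinarith [sq_nonneg ‖v‖, sq_nonneg ‖v'‖, abs_nonneg (‖v'‖ ^ 2 - ‖v‖ ^ 2)]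
    have h5 : (((1 - ‖v‖ ^ 2) ^ 2 : ℝ) : ℂ) * F - (((1 - ‖v'‖ ^ 2) ^ 2 : ℝ) : ℂ) * F' =
        (((1 - ‖v‖ ^ 2) ^ 2 : ℝ) : ℂ) * (F - F') +
          (((1 - ‖v‖ ^ 2) ^ 2 - (1 - ‖v'‖ ^ 2) ^ 2 : ℝ) : ℂ) * F' := by push_cast; ring
    calc _ ≤ ((1 - ‖v‖ ^ 2) ^ 2 * ‖F - F'‖ + 4 * ‖v - v'‖ * ‖F'‖) * (1 + ‖y‖) ^ 5 := by
          gcongr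
          rw [h5]
          refine (norm_add_le _ _).trans ?_
          rw [norm_mul, norm_mul, Complex.norm_real, Complex.norm_real,
            Real.norm_of_nonneg (by positivity), Real.norm_eq_abs]
          gcongr
      _ = (1 - ‖v‖ ^ 2) ^ 2 * (‖F - F'‖ * (1 + ‖y‖) ^ 5) +
          4 * ‖v - v'‖ * (‖F'‖ * (1 + ‖y‖) ^ 5) := by ring
      _ ≤ (1 - ‖v‖ ^ 2) ^ 2 * (C * ‖properVelocity v - properVelocity v'‖) +
          4 * ‖v - v'‖ * C := by gcongr
      _ = C * ((1 - ‖v‖ ^ 2) ^ 2 * ‖properVelocity v - properVelocity v'‖) +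
          4 * ‖v - v'‖ * C := by ring
      _ ≤ C * (3 * ‖v - v'‖) + 4 * ‖v - v'‖ * C := by gcongr
      _ = _ := by ring
  refine ⟨7 * C, fun v v' y hv' ↦ ?_⟩
  rcases le_or_gt 1 ‖v‖ with hv | hv
  · have hB' := one_sub_norm_sq_pos hv'
    obtain ⟨h2, -⟩ := hC y (properVelocity v') 0
    rw [weightedFourier_of_le_norm hv, zero_sub, norm_neg, weightedFourier_of_norm_lt hv',
      norm_mul, Complex.norm_real, Real.norm_of_nonneg (by positivity), mul_assoc]
    have h6 := norm_sub_norm_le v v'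
    have h7 : (1 - ‖v'‖ ^ 2) ^ 2 ≤ 2 * ‖v - v'‖ := by
      nlinarith [sq_nonneg ‖v'‖, norm_nonneg v']
    calc _ ≤ 2 * ‖v - v'‖ * C := by gcongr
      _ ≤ _ := by nlinarith [mul_nonneg hC0 (norm_nonneg (v - v'))]
  · rcases le_total ‖v'‖ ‖v‖ with h | h
    · exact inside v v' y hv h
    · rw [norm_sub_rev, norm_sub_rev v v']
      exact inside v' v y hv' h

lemma continuous_fourier_slice (T : SchwartzMap (V3 × V3) ℂ) :
    Continuous fun z : V3 × V3 ↦ 𝓕 (slice T z.1) z.2 := by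
  obtain ⟨C, hC⟩ := exists_norm_fourier_slice_le 0 T
  refine continuous_prod_of_continuous_lipschitzWith _ C.toNNReal
    (fun u ↦ (𝓕 (slice T u)).continuous) fun y ↦ ?_
  refine LipschitzWith.of_dist_le' fun u u' ↦ ?_
  simpa [dist_eq_norm] using (hC y u u').2

lemma measurable_weightedFourier (T : SchwartzMap (V3 × V3) ℂ) :
    Measurable fun z : V3 × V3 ↦ weightedFourier T z.1 z.2 := by
  have h := (continuous_fourier_slice T).measurable.comp
    ((measurable_properVelocity.comp measurable_fst).prodMk (measurable_snd (α := V3) (β := V3)))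
  unfold weightedFourier
  exact Measurable.mul (by fun_prop) h

lemma integral_comp_smul_sub (g : V3 → ℂ) (a : ℝ) (v₀ : V3) :
    ∫ v, g (a • (v - v₀)) = (((|a| ^ 3)⁻¹ : ℝ) : ℂ) * ∫ y, g y := by
  rw [integral_sub_right_eq_self (fun v ↦ g (a • v)) v₀, Measure.integral_comp_smul]
  simp [abs_inv, abs_pow]

lemma exists_norm_integral_weightedFourier_sub_le (T : SchwartzMap (V3 × V3) ℂ) :
    ∃ C, ∀ (a : ℝ) (v₀ : V3), a ≠ 0 → ‖v₀‖ < 1 →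
      ‖(∫ v, weightedFourier T v (a • (v - v₀))) -
        (((|a| ^ 3)⁻¹ * (1 - ‖v₀‖ ^ 2) ^ 2 : ℝ) : ℂ) * T (0, properVelocity v₀)‖ ≤
          C * (|a| ^ 4)⁻¹ := by
  obtain ⟨C, hC⟩ := exists_norm_weightedFourier_sub_le T
  have hC0 : 0 ≤ C := by
    have h := hC (EuclideanSpace.single 0 1) 0 0 (by simp)
    have h' : 0 ≤ C * ‖(EuclideanSpace.single 0 1 : V3) - 0‖ := le_trans (by positivity) h
    simpa using h'
  set J := ∫ y : V3, (1 + ‖y‖) ^ (-(4 : ℝ)) with hJ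
  refine ⟨C * J, fun a v₀ ha hv₀ ↦ ?_⟩
  have hB := one_sub_norm_sq_pos hv₀
  have hconst : Integrable fun v ↦ weightedFourier T v₀ (a • (v - v₀)) := by
    have h : Integrable (weightedFourier T v₀) :=
      (𝓕 (slice T (properVelocity v₀))).integrable.const_mul _
    exact (h.comp_smul ha).comp_sub_right v₀
  have hbound : Integrable fun v : V3 ↦ C * |a|⁻¹ * (1 + ‖a • (v - v₀)‖) ^ (-(4 : ℝ)) :=
    ((integrable_one_add_norm_rpow_neg_four.comp_smul ha).comp_sub_right v₀).const_mul _
  have hle (v : V3) : ‖weightedFourier T v (a • (v - v₀)) - weightedFourier T v₀ (a • (v - v₀))‖ ≤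
      C * |a|⁻¹ * (1 + ‖a • (v - v₀)‖) ^ (-(4 : ℝ)) := by
    set y := a • (v - v₀) with hy
    have hvy : ‖v - v₀‖ = |a|⁻¹ * ‖y‖ := by
      rw [hy, norm_smul, Real.norm_eq_abs, inv_mul_cancel_left₀ (abs_ne_zero.2 ha)]
    have h := hC v v₀ y hv₀
    rw [hvy] at h
    rw [Real.rpow_neg (by positivity), show (4 : ℝ) = (4 : ℕ) by norm_num, Real.rpow_natCast,
      ← div_eq_mul_inv, le_div_iff₀ (by positivity)]
    refine le_of_mul_le_mul_right ?_ (show 0 < 1 + ‖y‖ by positivity)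
    calc _ = ‖weightedFourier T v y - weightedFourier T v₀ y‖ * (1 + ‖y‖) ^ 5 := by ring
      _ ≤ C * (|a|⁻¹ * ‖y‖) := h
      _ ≤ C * (|a|⁻¹ * (1 + ‖y‖)) := by gcongr; linarith
      _ = _ := by ring
  have hmeas : Measurable fun v ↦ weightedFourier T v (a • (v - v₀)) :=
    (measurable_weightedFourier T).comp
      (g := fun z : V3 × V3 ↦ weightedFourier T z.1 z.2) (f := fun v ↦ (v, a • (v - v₀)))
      (by fun_prop)
  have hdiff : Integrable fun v ↦
      weightedFourier T v (a • (v - v₀)) - weightedFourier T v₀ (a • (v - v₀)) :=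
    hbound.mono' (hmeas.aestronglyMeasurable.sub hconst.aestronglyMeasurable) (.of_forall hle)
  have hintegrable : Integrable fun v ↦ weightedFourier T v (a • (v - v₀)) := by
    simpa [Pi.add_def] using hdiff.add hconst
  have hval : ∫ v, weightedFourier T v₀ (a • (v - v₀)) =
      (((|a| ^ 3)⁻¹ * (1 - ‖v₀‖ ^ 2) ^ 2 : ℝ) : ℂ) * T (0, properVelocity v₀) := by
    rw [integral_comp_smul_sub]
    simp_rw [weightedFourier_of_norm_lt hv₀]
    rw [integral_const_mul, integral_fourier_slice, ← mul_assoc, ← Complex.ofReal_mul]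
  rw [← hval, ← integral_sub hintegrable hconst]
  refine (norm_integral_le_of_norm_le hbound (.of_forall hle)).trans (le_of_eq ?_)
  rw [integral_const_mul,
    integral_sub_right_eq_self (fun v : V3 ↦ (1 + ‖a • v‖) ^ (-(4 : ℝ))) v₀,
    Measure.integral_comp_smul volume (fun v : V3 ↦ (1 + ‖v‖) ^ (-(4 : ℝ))), ← hJ]
  simp only [finrank_euclideanSpace_fin, abs_inv, abs_pow, smul_eq_mul]
  field_simp

lemma Iminus_eq_integral_weightedFourier {m : ℝ} (hm : 0 < m) (f : SchwartzMap (V3 × V3) ℂ)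
    {x0 : ℝ} (hx0 : x0 ≠ 0) (xv : V3) :
    Iminus m f x0 xv = ((((2 * π) ^ 3)⁻¹ : ℝ) : ℂ) *
      ∫ v, weightedFourier (amplitude hm f 2) v ((x0 / (2 * π)) • (v - x0⁻¹ • xv)) := by
  rw [Iminus_eq_integral_ball hm f 2, ← setIntegral_eq_integral_of_forall_compl_eq_zero
    (s := Metric.ball (0 : V3) 1) fun v hv ↦ weightedFourier_of_le_norm (by simpa using hv) _]
  congr 1
  refine setIntegral_congr_fun measurableSet_ball fun v hv ↦ ?_
  have hy : (2 * π)⁻¹ • (x0 • v - xv) = (x0 / (2 * π)) • (v - x0⁻¹ • xv) := by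
    rw [div_eq_inv_mul, mul_smul, smul_sub x0, smul_inv_smul₀ hx0]
  simp only [weightedFourier_of_norm_lt (mem_ball_zero_iff.1 hv), hy]

lemma amplitude_zero_properVelocity {m : ℝ} (hm : 0 < m) (f : SchwartzMap (V3 × V3) ℂ) {v : V3}
    (hv : ‖v‖ < 1) :
    (((1 - ‖v‖ ^ 2) ^ 2 : ℝ) : ℂ) * amplitude hm f 2 (0, properVelocity v) =
      (((m / √(1 - ‖v‖ ^ 2)) ^ 3 : ℝ) : ℂ) * f (m • properVelocity v, m • properVelocity v) := by
  have hB := one_sub_norm_sq_pos hv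
  have hscale (u : V3) : energyScale m 0 u = 2 * m := by
    rw [energyScale, Real.sqrt_eq_iff_mul_self_eq_of_pos (by positivity)]
    simp
    ring
  have hmomenta (u : V3) : momenta m (0, u) = (m • u, m • u) := by
    simp only [momenta, hscale, add_zero, sub_zero, smul_smul]
    ring_nf
  rw [amplitude_apply, hmomenta, hscale, ← mul_assoc, ← Complex.ofReal_mul,
    one_add_norm_properVelocity_sq hv, Real.rpow_add (by positivity), Real.rpow_natCast, inv_pow,
    show (3 / 2 : ℝ) = 1 + 1 / 2 by norm_num, Real.rpow_add (by positivity), Real.rpow_one,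
    ← Real.sqrt_eq_rpow, Real.sqrt_inv]
  congr 2
  have hs : 0 < √(1 - ‖v‖ ^ 2) := Real.sqrt_pos.2 hB
  have hsq := Real.sq_sqrt hB.le
  set s := √(1 - ‖v‖ ^ 2)
  rw [← hsq]
  field_simp

lemma exists_norm_Iminus_sub_le {m : ℝ} (hm : 0 < m) (f : SchwartzMap (V3 × V3) ℂ) :
    ∃ C : ℝ, ∀ (x0 : ℝ) (xv : V3), 1 ≤ x0 ^ 2 - ‖xv‖ ^ 2 →
      ∀ lam : ℝ, lam = Real.sign x0 * Real.sqrt (x0 ^ 2 - ‖xv‖ ^ 2) →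
      ∀ uv : V3, uv = lam⁻¹ • xv →
        ‖Iminus m f x0 xv - (((m / |lam|) ^ 3 : ℝ) : ℂ) * f (m • uv, m • uv)‖ ≤
          C * (1 + Real.sqrt (x0 ^ 2 + ‖xv‖ ^ 2)) ^ (-(4 : ℝ)) := by
  obtain ⟨C, hC⟩ := exists_norm_integral_weightedFourier_sub_le (amplitude hm f 2)
  have hC0 : 0 ≤ C := by simpa using (norm_nonneg _).trans (hC 1 0 one_ne_zero (by simp))
  refine ⟨2 * π * C * 3 ^ 4, fun x0 xv hx lam hlam uv huv ↦ ?_⟩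
  have habs : 1 ≤ |x0| := by
    rw [← one_le_sq_iff_one_le_abs]
    linarith [sq_nonneg ‖xv‖]
  have hx0 : x0 ≠ 0 := abs_pos.1 (by linarith)
  have hx0' : 0 < |x0| := abs_pos.2 hx0
  set v₀ := x0⁻¹ • xv with hv₀def
  have hnorm : ‖v₀‖ ^ 2 = ‖xv‖ ^ 2 / x0 ^ 2 := by
    rw [hv₀def, norm_smul, mul_pow, norm_inv, inv_pow, Real.norm_eq_abs, sq_abs, inv_mul_eq_div]
  have hv₀ : ‖v₀‖ < 1 := by
    have : ‖v₀‖ ^ 2 < 1 := by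
      rw [hnorm, div_lt_one (by positivity)]
      linarith
    nlinarith [norm_nonneg v₀]
  have hlam' : lam = x0 * √(1 - ‖v₀‖ ^ 2) := by
    have h : x0 ^ 2 - ‖xv‖ ^ 2 = x0 ^ 2 * (1 - ‖v₀‖ ^ 2) := by
      rw [hnorm]
      field_simp
    have hsign : Real.sign x0 * |x0| = x0 := by
      rcases hx0.lt_or_gt with h | h
      · simp [Real.sign_of_neg h, abs_of_neg h]
      · simp [Real.sign_of_pos h, abs_of_pos h]
    rw [hlam, h, Real.sqrt_mul (sq_nonneg _), Real.sqrt_sq_eq_abs, ← mul_assoc, hsign]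
  have huv' : uv = properVelocity v₀ := by
    rw [huv, hlam', properVelocity, hv₀def, smul_smul, mul_inv, mul_comm]
  have hmain : (((m / |lam|) ^ 3 : ℝ) : ℂ) * f (m • uv, m • uv) =
      ((((2 * π) ^ 3)⁻¹ : ℝ) : ℂ) * ((((|x0 / (2 * π)| ^ 3)⁻¹ * (1 - ‖v₀‖ ^ 2) ^ 2 : ℝ) : ℂ) *
        amplitude hm f 2 (0, properVelocity v₀)) := by
    rw [Complex.ofReal_mul, mul_assoc, amplitude_zero_properVelocity hm f hv₀, ← huv',
      ← mul_assoc, ← mul_assoc, ← Complex.ofReal_mul, ← Complex.ofReal_mul, hlam', abs_mul,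
      abs_of_nonneg (Real.sqrt_nonneg _), abs_div, abs_of_pos Real.two_pi_pos]
    congr 2
    field_simp
  rw [hmain, Iminus_eq_integral_weightedFourier hm f hx0, ← mul_sub, norm_mul, Complex.norm_real,
    Real.norm_of_nonneg (by positivity)]
  have hR : 1 + √(x0 ^ 2 + ‖xv‖ ^ 2) ≤ 3 * |x0| := by
    have : √(x0 ^ 2 + ‖xv‖ ^ 2) ≤ 2 * |x0| :=
      Real.sqrt_le_iff.2 ⟨by positivity, by nlinarith [sq_abs x0]⟩
    linarith
  have ha : x0 / (2 * π) ≠ 0 := by positivity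
  calc _ ≤ ((2 * π) ^ 3)⁻¹ * (C * (|x0 / (2 * π)| ^ 4)⁻¹) := by
        gcongr
        exact hC _ _ ha hv₀
    _ = 2 * π * C * 3 ^ 4 * ((3 * |x0|) ^ 4)⁻¹ := by
        rw [abs_div, abs_of_pos Real.two_pi_pos]
        field_simp
    _ ≤ _ := by
        rw [Real.rpow_neg (by positivity), show (4 : ℝ) = (4 : ℕ) by norm_num, Real.rpow_natCast]
        gcongr

end Leading

theorem Iminus_asymptotics (m : ℝ) (hm : 0 < m) (f : SchwartzMap (V3 × V3) ℂ) :
    -- (i) timelike region x·x ≥ 1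
    (∃ C : ℝ, ∀ (x0 : ℝ) (xv : V3), 1 ≤ x0 ^ 2 - ‖xv‖ ^ 2 →
      ∀ lam : ℝ, lam = Real.sign x0 * Real.sqrt (x0 ^ 2 - ‖xv‖ ^ 2) →
      ∀ uv : V3, uv = lam⁻¹ • xv →
        ‖Iminus m f x0 xv -
          (((m / |lam|) ^ 3 : ℝ) : ℂ) * f (m • uv, m • uv)‖ ≤
          C * (1 + Real.sqrt (x0 ^ 2 + ‖xv‖ ^ 2)) ^ (-(4 : ℝ))) ∧
    -- (ii) complement x·x < 1
    (∀ N : ℕ, ∃ C : ℝ, ∀ (x0 : ℝ) (xv : V3), x0 ^ 2 - ‖xv‖ ^ 2 < 1 →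
      ‖Iminus m f x0 xv‖ ≤ C * (1 + Real.sqrt (x0 ^ 2 + ‖xv‖ ^ 2)) ^ (-(N : ℝ))) := by
  exact ⟨exists_norm_Iminus_sub_le hm f, exists_norm_Iminus_le hm f⟩

end
end

section
/- Let m > 0, let J: ℝ⁴ → ℂ be a Schwartz function, and let p = (p⁰,p⃗) with p⃗ ∈ ℝ³ and p⁰ = ω_m(p⃗). Then (1/p⁰) ∫_{ℝ³} Ĵ((p⃗·r⃗)/p⁰, r⃗) · (|r⃗|² − ((p⃗·r⃗)/p⁰)²)^{-1} d³r⃗ = π ∫_{ℝ⁴} J(x) ((p·x)² − m²(x·x))^{-1/2} dx. Both integrals converge absolutely: on the left, |r⃗|² − ((p⃗·r⃗)/p⁰)² ≥ (m²/(p⁰)²)|r⃗|², and on the right (p·x)² − m²(x·x) > 0 for x not proportional to p, with a locally integrable inverse square root. -/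
/-!
Statement 10: for a Schwartz function `J` on ℝ⁴ and `p = (ω_m(p⃗), p⃗)`,
`(1/p⁰) ∫ Ĵ((p⃗·r⃗)/p⁰, r⃗) (|r⃗|² − ((p⃗·r⃗)/p⁰)²)^{-1} d³r⃗
  = π ∫ J(x) ((p·x)² − m²(x·x))^{-1/2} dx`,
together with absolute convergence of both integrals.
-/

open Real Complex MeasureTheory
open scoped InnerProductSpace

noncomputable section

/-- Minkowski-signature Fourier transform `Ĵ(k) = (2π)^{-1} ∫ e^{i(k⁰x⁰ − k⃗·x⃗)} J(x) dx`,
four-vectors represented as pairs `(x⁰, x⃗) : ℝ × V3`. -/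
def minkFT (J : ℝ × V3 → ℂ) (k : ℝ × V3) : ℂ :=
  (2 * (π : ℂ))⁻¹ *
    ∫ x : ℝ × V3, Complex.exp (Complex.I * ((k.1 * x.1 - ⟪k.2, x.2⟫_ℝ : ℝ) : ℂ)) * J x

instance isAddHaarMeasure_volume_spacetime : (volume : Measure (ℝ × V3)).IsAddHaarMeasure :=
  Measure.prod.instIsAddHaarMeasure volume volume

open Set in
/-- A radial weight on `ℝ³` that dominates the Coulomb-type kernels at the origin and at infinity. -/
lemma integrable_inv_one_add_normSq_mul_inv_normSq :
    Integrable (fun z : V3 => (1 + ‖z‖ ^ 2)⁻¹ * (‖z‖ ^ 2)⁻¹) := by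
  rw [integrable_fun_norm_addHaar volume (f := fun y : ℝ => (1 + y ^ 2)⁻¹ * (y ^ 2)⁻¹)]
  refine integrable_inv_one_add_sq.integrableOn.congr_fun (fun y hy => ?_) measurableSet_Ioi
  have hy : (y : ℝ) ≠ 0 := ne_of_gt hy
  simp only [finrank_euclideanSpace, Fintype.card_fin, smul_eq_mul]
  field_simp

/-- The pairing `(x, r) ↦ ⟪x.2, r⟫ / (2π)`. -/
def spatialPairing : (ℝ × V3) →L[ℝ] V3 →L[ℝ] ℝ :=
  (2 * π)⁻¹ • (innerSL ℝ).comp (ContinuousLinearMap.snd ℝ ℝ V3)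

lemma spatialPairing_apply (x : ℝ × V3) (r : V3) :
    spatialPairing x r = (2 * π)⁻¹ * ⟪x.2, r⟫_ℝ := rfl

lemma minkFT_zero_eq_fourierIntegral (f : ℝ × V3 → ℂ) (r : V3) :
    minkFT f (0, r) = (2 * (π : ℂ))⁻¹ *
      VectorFourier.fourierIntegral Real.fourierChar volume spatialPairing.toLinearMap₁₂ f r := by
  unfold minkFT VectorFourier.fourierIntegral
  congr 1
  refine integral_congr_ae (Filter.Eventually.of_forall fun x => ?_)
  have hpi : (π : ℂ) ≠ 0 := by exact_mod_cast Real.pi_ne_zero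
  have hL : spatialPairing.toLinearMap₁₂ x r = (2 * π)⁻¹ * ⟪x.2, r⟫_ℝ := rfl
  simp only [hL, Circle.smul_def, Real.fourierChar_apply, smul_eq_mul]
  rw [real_inner_comm]
  congr 2
  push_cast
  field_simp
  ring

lemma continuous_minkFT_zero (J : SchwartzMap (ℝ × V3) ℂ) :
    Continuous (fun r : V3 => minkFT (fun x => J x) (0, r)) := by
  simp only [minkFT_zero_eq_fourierIntegral]
  exact continuous_const.mul (VectorFourier.fourierIntegral_continuous Real.continuous_fourierChar
    spatialPairing.continuous₂ J.integrable)

lemma exists_norm_minkFT_zero_le (J : SchwartzMap (ℝ × V3) ℂ) :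
    ∃ C, ∀ r : V3, ‖minkFT (fun x => J x) (0, r)‖ ≤ C * (1 + ‖r‖ ^ 2)⁻¹ := by
  have key := fun n : ℕ => fun r : V3 =>
    VectorFourier.pow_mul_norm_iteratedFDeriv_fourierIntegral_le (μ := volume) spatialPairing
      (f := fun x => J x) (K := 0) (N := ⊤) (J.smooth ⊤)
      (fun k n _ _ => J.integrable_pow_mul_iteratedFDeriv volume k n) (k := 0) (n := n)
      le_rfl (by simp) (0, r) r
  simp only [norm_iteratedFDeriv_zero, pow_zero, mul_one, spatialPairing_apply,
    real_inner_self_eq_norm_sq] at key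
  obtain ⟨A, hA⟩ : ∃ A, ∀ r : V3, ‖minkFT (fun x => J x) (0, r)‖ ≤ A := by
    refine ⟨‖(2 * (π : ℂ))⁻¹‖ * ∫ x, ‖J x‖, fun r => ?_⟩
    rw [minkFT_zero_eq_fourierIntegral, norm_mul]
    gcongr
    exact VectorFourier.norm_fourierIntegral_le_integral_norm _ _ _ _ _
  obtain ⟨B, hB⟩ : ∃ B, ∀ r : V3, ‖r‖ ^ 2 * ‖minkFT (fun x => J x) (0, r)‖ ≤ B := by
    have h2 := key 2
    set S := ∑ p ∈ Finset.range (0 + 1) ×ˢ Finset.range (2 + 1),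
      ∫ v, ‖v‖ ^ p.1 * ‖iteratedFDeriv ℝ p.2 (fun x => J x) v‖
    refine ⟨‖(2 * (π : ℂ))⁻¹‖ * ((2 * π) ^ 2 * (4 * S)), fun r => ?_⟩
    rw [minkFT_zero_eq_fourierIntegral, norm_mul, mul_left_comm]
    refine mul_le_mul_of_nonneg_left ?_ (norm_nonneg _)
    have h := h2 r
    have hn : ‖((0 : ℝ), r)‖ = ‖r‖ := by simp [Prod.norm_def]
    rw [hn, sq_abs] at h
    rcases eq_or_ne r 0 with rfl | hr
    · have : 0 ≤ S := by positivity
      simp only [norm_zero]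
      rw [zero_pow two_ne_zero, zero_mul]
      positivity
    · have hr' : 0 < ‖r‖ ^ 2 := by positivity
      refine le_of_mul_le_mul_left ?_ hr'
      have hp : 0 < (2 * π) ^ 2 := by positivity
      have h' := mul_le_mul_of_nonneg_left h hp.le
      refine (le_of_eq ?_).trans (h'.trans (le_of_eq ?_))
      · field_simp
      · push_cast; ring
  refine ⟨A + B, fun r => ?_⟩
  rw [← div_eq_mul_inv, le_div_iff₀ (by positivity)]
  linarith [hA r, hB r]

lemma integrable_minkFT_zero_mul_inv_normSq (J : SchwartzMap (ℝ × V3) ℂ) :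
    Integrable (fun r : V3 => minkFT (fun x => J x) (0, r) * ((‖r‖ ^ 2 : ℝ) : ℂ)⁻¹) := by
  obtain ⟨C, hC⟩ := exists_norm_minkFT_zero_le J
  refine (integrable_inv_one_add_normSq_mul_inv_normSq.const_mul C).mono'
    ((continuous_minkFT_zero J).measurable.mul (by fun_prop)).aestronglyMeasurable
    (Filter.Eventually.of_forall fun r => ?_)
  rw [norm_mul, norm_inv, Complex.norm_real, Real.norm_of_nonneg (by positivity), ← mul_assoc]
  exact mul_le_mul_of_nonneg_right (hC r) (by positivity)

lemma integrable_schwartz_mul_inv_norm_snd (J : SchwartzMap (ℝ × V3) ℂ) :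
    Integrable (fun x : ℝ × V3 => J x * ((‖x.2‖⁻¹ : ℝ) : ℂ)) := by
  set C := 2 ^ 5 * (Finset.Iic (5, 0)).sup (fun m => SchwartzMap.seminorm ℝ m.1 m.2) J
  have hC : ∀ x, (1 + ‖x‖) ^ 5 * ‖J x‖ ≤ C := fun x => by
    simpa using SchwartzMap.one_add_le_sup_seminorm_apply (𝕜 := ℝ) (m := (5, 0)) (k := 5) (n := 0)
      le_rfl le_rfl J x
  have hint : Integrable (fun x : ℝ × V3 =>
      (1 + x.1 ^ 2)⁻¹ * ((1 + ‖x.2‖ ^ 2)⁻¹ * (‖x.2‖ ^ 2)⁻¹)) :=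
    integrable_inv_one_add_sq.mul_prod integrable_inv_one_add_normSq_mul_inv_normSq
  refine (hint.const_mul C).mono'
    (J.continuous.measurable.mul (by fun_prop)).aestronglyMeasurable
    (Filter.Eventually.of_forall fun x => ?_)
  rw [norm_mul, Complex.norm_real, Real.norm_of_nonneg (by positivity)]
  rcases eq_or_ne x.2 0 with h0 | h0
  · simp [h0]
  have hz : 0 < ‖x.2‖ := norm_pos_iff.2 h0
  have h1 : |x.1| ≤ ‖x‖ := norm_fst_le x
  have h2 : ‖x.2‖ ≤ ‖x‖ := norm_snd_le x
  have hb : (1 + x.1 ^ 2) * (1 + ‖x.2‖ ^ 2) * ‖x.2‖ ≤ (1 + ‖x‖) ^ 5 := by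
    have e1 : 1 + x.1 ^ 2 ≤ (1 + ‖x‖) ^ 2 := by
      rw [← sq_abs]; nlinarith [abs_nonneg x.1]
    have e2 : 1 + ‖x.2‖ ^ 2 ≤ (1 + ‖x‖) ^ 2 := by nlinarith
    calc _ ≤ (1 + ‖x‖) ^ 2 * (1 + ‖x‖) ^ 2 * (1 + ‖x‖) := by gcongr; linarith
      _ = _ := by ring
  have hJ := (mul_le_mul_of_nonneg_right hb (norm_nonneg (J x))).trans (hC x)
  have : ‖J x‖ * ‖x.2‖⁻¹ = ((1 + x.1 ^ 2) * (1 + ‖x.2‖ ^ 2) * ‖x.2‖ * ‖J x‖) *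
      ((1 + x.1 ^ 2)⁻¹ * ((1 + ‖x.2‖ ^ 2)⁻¹ * (‖x.2‖ ^ 2)⁻¹)) := by
    have : 1 + x.1 ^ 2 ≠ 0 := by positivity
    field_simp
  rw [this]
  exact mul_le_mul_of_nonneg_right hJ (by positivity)

open Set in
lemma integrableOn_exp_neg_mul_Ioi {s : ℝ} (hs : 0 < s) :
    IntegrableOn (fun t : ℝ => Real.exp (-t * s)) (Ioi 0) := by
  refine (integrableOn_exp_mul_Ioi (neg_lt_zero.2 hs) 0).congr_fun (fun t _ => ?_) measurableSet_Ioi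
  simp only; congr 1; ring

open Set in
lemma integral_exp_neg_mul_Ioi_eq_inv {s : ℝ} (hs : 0 < s) :
    ∫ t in Ioi (0 : ℝ), Real.exp (-t * s) = s⁻¹ := by
  have h := integral_exp_mul_Ioi (neg_lt_zero.2 hs) 0
  simp only [mul_zero, Real.exp_zero, neg_div_neg_eq, one_div] at h
  rw [← h]
  congr 1 with t
  congr 1; ring

/-- The three-dimensional heat kernel (up to normalization), as a function of time and distance. -/
def heatKernel (t s : ℝ) : ℝ := (π / t) ^ (3 / 2 : ℝ) * Real.exp (-s ^ 2 / (4 * t))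

lemma heatKernel_nonneg {t : ℝ} (ht : 0 < t) (s : ℝ) : 0 ≤ heatKernel t s := by
  unfold heatKernel; positivity

lemma measurable_heatKernel : Measurable (fun q : ℝ × ℝ => heatKernel q.1 q.2) := by
  unfold heatKernel; fun_prop

lemma heatKernel_eq_comp_inv {t s : ℝ} (ht : 0 < t) :
    heatKernel t s = t ^ ((-1 : ℝ) - 1) •
      (π ^ (3 / 2 : ℝ) * ((t ^ (-1 : ℝ)) ^ ((1 / 2 : ℝ) - 1) *
        Real.exp (-(s ^ 2 / 4 * t ^ (-1 : ℝ))))) := by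
  have e : (t ^ (-1 : ℝ)) ^ ((1 / 2 : ℝ) - 1) = t ^ (1 / 2 : ℝ) := by
    rw [← Real.rpow_mul ht.le]; norm_num
  rw [e, smul_eq_mul, heatKernel, Real.div_rpow Real.pi_pos.le ht.le]
  have e2 : t ^ ((-1 : ℝ) - 1) * t ^ (1 / 2 : ℝ) = (t ^ (3 / 2 : ℝ))⁻¹ := by
    rw [← Real.rpow_add ht, ← Real.rpow_neg ht.le]; norm_num
  have e3 : -s ^ 2 / (4 * t) = -(s ^ 2 / 4 * t ^ (-1 : ℝ)) := by
    rw [Real.rpow_neg_one]; field_simp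
  rw [e3, div_eq_mul_inv, ← e2]
  ring

open Set in
lemma integrableOn_heatKernel {s : ℝ} (hs : 0 < s) :
    IntegrableOn (fun t => heatKernel t s) (Ioi 0) := by
  refine ((integrableOn_Ioi_comp_rpow_iff' (fun u : ℝ => π ^ (3 / 2 : ℝ) *
    (u ^ ((1 / 2 : ℝ) - 1) * Real.exp (-(s ^ 2 / 4 * u)))) (p := -1) (by norm_num)).2 ?_).congr_fun
    (fun t ht => (heatKernel_eq_comp_inv ht).symm) measurableSet_Ioi
  refine Integrable.const_mul ?_ _
  have := integrableOn_rpow_mul_exp_neg_mul_rpow (p := 1) (s := (1 / 2 : ℝ) - 1) (b := s ^ 2 / 4)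
    (by norm_num) one_pos (by positivity)
  simpa only [Real.rpow_one, neg_mul, IntegrableOn] using this

open Set in
lemma integral_heatKernel {s : ℝ} (hs : 0 < s) :
    ∫ t in Ioi 0, heatKernel t s = 2 * π ^ 2 * s⁻¹ := by
  have h := integral_comp_rpow_Ioi (fun u : ℝ => π ^ (3 / 2 : ℝ) *
    (u ^ ((1 / 2 : ℝ) - 1) * Real.exp (-(s ^ 2 / 4 * u)))) (p := -1) (by norm_num)
  rw [integral_const_mul, Real.integral_rpow_mul_exp_neg_mul_Ioi (by norm_num) (by positivity),
    Real.Gamma_one_half_eq] at h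
  rw [setIntegral_congr_fun measurableSet_Ioi fun t ht => heatKernel_eq_comp_inv ht]
  simp only [abs_neg, abs_one, one_mul] at h
  rw [h]
  have e1 : (1 / (s ^ 2 / 4)) ^ (1 / 2 : ℝ) = 2 * s⁻¹ := by
    rw [← Real.sqrt_eq_rpow, show 1 / (s ^ 2 / 4) = (2 * s⁻¹) ^ 2 by field_simp; norm_num]
    exact Real.sqrt_sq (by positivity)
  have e2 : π ^ (3 / 2 : ℝ) * √π = π ^ 2 := by
    rw [Real.sqrt_eq_rpow, ← Real.rpow_add Real.pi_pos]; norm_num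
  rw [e1, ← e2]
  ring

lemma integral_phase_mul_gaussian {t : ℝ} (ht : 0 < t) (x : ℝ × V3) :
    ∫ r : V3, Complex.exp (I * (((0 : ℝ) * x.1 - ⟪r, x.2⟫_ℝ : ℝ) : ℂ)) *
      ((Real.exp (-t * ‖r‖ ^ 2) : ℝ) : ℂ) = ((heatKernel t ‖x.2‖ : ℝ) : ℂ) := by
  have h := GaussianFourier.integral_cexp_neg_mul_sq_norm_add (V := V3) (b := (t : ℂ))
    (by simpa) (-I) x.2
  have e : ((π / t : ℝ) : ℂ) ^ (((3 / 2 : ℝ) : ℂ)) = (((π / t) ^ (3 / 2 : ℝ) : ℝ) : ℂ) :=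
    (Complex.ofReal_cpow (by positivity) _).symm
  rw [heatKernel, Complex.ofReal_mul, ← e]
  simp only [finrank_euclideanSpace, Fintype.card_fin] at h
  convert! h using 1
  · refine integral_congr_ae (Filter.Eventually.of_forall fun r => ?_)
    simp only [Complex.ofReal_exp, ← Complex.exp_add]
    rw [real_inner_comm]
    congr 1
    push_cast
    ring
  · push_cast
    congr 2
    simp

/-- The Fourier transform of `1 / ‖r‖²` on `ℝ³`, tested against a Schwartz function. -/
lemma integral_minkFT_zero_mul_inv_normSq (J : SchwartzMap (ℝ × V3) ℂ) :
    ∫ r : V3, minkFT (fun x => J x) (0, r) * ((‖r‖ ^ 2 : ℝ) : ℂ)⁻¹ =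
      π * ∫ x : ℝ × V3, J x * ((‖x.2‖⁻¹ : ℝ) : ℂ) := by
  set μ : Measure ℝ := volume.restrict (Set.Ioi 0)
  have hpos : ∀ᵐ t ∂μ, 0 < t := ae_restrict_mem measurableSet_Ioi
  have hr0 : ∀ᵐ r : V3, r ≠ 0 := by simp [ae_iff]
  have hx0 : ∀ᵐ x : ℝ × V3, x.2 ≠ 0 := by
    exact (Measure.quasiMeasurePreserving_snd (μ := (volume : Measure ℝ))
      (ν := (volume : Measure V3))).ae hr0
  set F : V3 → ℂ := fun r => minkFT (fun x => J x) (0, r) with hF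
  have hFc : Continuous F := continuous_minkFT_zero J
  have hF1 : Integrable (Function.uncurry fun (r : V3) (t : ℝ) =>
      F r * ((Real.exp (-t * ‖r‖ ^ 2) : ℝ) : ℂ)) (volume.prod μ) := by
    have hm : AEStronglyMeasurable (Function.uncurry fun (r : V3) (t : ℝ) =>
      F r * ((Real.exp (-t * ‖r‖ ^ 2) : ℝ) : ℂ)) (volume.prod μ) := by
      apply Continuous.aestronglyMeasurable
      unfold Function.uncurry
      fun_prop
    refine (integrable_prod_iff hm).2 ⟨?_, ?_⟩
    · filter_upwards [hr0] with r hr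
      have h := (integrableOn_exp_neg_mul_Ioi (s := ‖r‖ ^ 2) (by positivity)).integrable.ofReal
        (𝕜 := ℂ)
      exact h.const_mul (F r)
    · refine (integrable_minkFT_zero_mul_inv_normSq J).norm.congr ?_
      filter_upwards [hr0] with r hr
      simp only [Function.uncurry_apply_pair, norm_mul, Complex.norm_real,
        Real.norm_eq_abs, Real.abs_exp]
      rw [integral_const_mul, integral_exp_neg_mul_Ioi_eq_inv (s := ‖r‖ ^ 2) (by positivity)]
      simp [hF]
  have hF2 : Integrable (Function.uncurry fun (t : ℝ) (x : ℝ × V3) =>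
      J x * ((heatKernel t ‖x.2‖ : ℝ) : ℂ)) (μ.prod volume) := by
    have hm : AEStronglyMeasurable (Function.uncurry fun (t : ℝ) (x : ℝ × V3) =>
      J x * ((heatKernel t ‖x.2‖ : ℝ) : ℂ)) (μ.prod volume) := by
      apply Measurable.aestronglyMeasurable
      refine (J.continuous.measurable.comp measurable_snd).mul
        (Complex.measurable_ofReal.comp (measurable_heatKernel.comp
          (measurable_fst.prodMk measurable_snd.snd.norm)))
    refine (integrable_prod_iff' hm).2 ⟨?_, ?_⟩
    · filter_upwards [hx0] with x hx
      have h := (integrableOn_heatKernel (norm_pos_iff.2 hx)).integrable.ofReal (𝕜 := ℂ)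
      exact h.const_mul (J x)
    · refine ((integrable_schwartz_mul_inv_norm_snd J).norm.const_mul (2 * π ^ 2)).congr ?_
      filter_upwards [hx0] with x hx
      simp only [Function.uncurry_apply_pair, norm_mul, Complex.norm_real]
      rw [integral_const_mul, integral_congr_ae (hpos.mono fun t ht =>
        Real.norm_of_nonneg (heatKernel_nonneg ht _)), integral_heatKernel (norm_pos_iff.2 hx)]
      simp; ring
  have hgauss : ∀ t, 0 < t → ∫ r, F r * ((Real.exp (-t * ‖r‖ ^ 2) : ℝ) : ℂ) =
      (2 * (π : ℂ))⁻¹ * ∫ x, J x * ((heatKernel t ‖x.2‖ : ℝ) : ℂ) := by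
    intro t ht
    have hg : Integrable fun r : V3 => Real.exp (-t * ‖r‖ ^ 2) := by
      have := (GaussianFourier.integrable_cexp_neg_mul_sq_norm_add (V := V3) (b := (t : ℂ))
        (by simpa) 0 0).re
      refine this.congr (Filter.Eventually.of_forall fun r => ?_)
      simp only [zero_mul, add_zero]
      exact_mod_cast Complex.exp_ofReal_re _
    have hi : Integrable (Function.uncurry fun (r : V3) (x : ℝ × V3) =>
        Complex.exp (I * (((0 : ℝ) * x.1 - ⟪r, x.2⟫_ℝ : ℝ) : ℂ)) * J x *
          ((Real.exp (-t * ‖r‖ ^ 2) : ℝ) : ℂ)) (volume.prod volume) := by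
      refine (hg.mul_prod J.integrable.norm).mono' ?_ (Filter.Eventually.of_forall fun q => ?_)
      · apply Continuous.aestronglyMeasurable
        unfold Function.uncurry
        have := J.continuous
        fun_prop
      · simp only [Function.uncurry, norm_mul]
        rw [mul_comm I, Complex.norm_exp_ofReal_mul_I, one_mul, mul_comm, Complex.norm_real,
          Real.norm_eq_abs, Real.abs_exp]
    calc _ = (2 * (π : ℂ))⁻¹ * ∫ r : V3, ∫ x : ℝ × V3,
          Complex.exp (I * (((0 : ℝ) * x.1 - ⟪r, x.2⟫_ℝ : ℝ) : ℂ)) * J x *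
          ((Real.exp (-t * ‖r‖ ^ 2) : ℝ) : ℂ) := by
            rw [← integral_const_mul]
            simp only [hF, minkFT, integral_mul_const, ← mul_assoc]
      _ = _ := by
        rw [integral_integral_swap hi]
        congr 1
        refine integral_congr_ae (Filter.Eventually.of_forall fun x => ?_)
        simp only [← integral_phase_mul_gaussian ht x]
        rw [← integral_const_mul]
        congr 1 with r
        ring
  calc ∫ r : V3, F r * ((‖r‖ ^ 2 : ℝ) : ℂ)⁻¹
      = ∫ r, ∫ t, F r * ((Real.exp (-t * ‖r‖ ^ 2) : ℝ) : ℂ) ∂μ := by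
        refine integral_congr_ae ?_
        filter_upwards [hr0] with r hr
        rw [integral_const_mul, integral_complex_ofReal,
          integral_exp_neg_mul_Ioi_eq_inv (s := ‖r‖ ^ 2) (by positivity), Complex.ofReal_inv]
    _ = ∫ t, (∫ r, F r * ((Real.exp (-t * ‖r‖ ^ 2) : ℝ) : ℂ)) ∂μ := integral_integral_swap hF1
    _ = (2 * (π : ℂ))⁻¹ * ∫ t, (∫ x, J x * ((heatKernel t ‖x.2‖ : ℝ) : ℂ)) ∂μ := by
        rw [← integral_const_mul]
        exact integral_congr_ae (hpos.mono fun t ht => hgauss t ht)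
    _ = (2 * (π : ℂ))⁻¹ * ∫ x, (2 * π ^ 2) * (J x * ((‖x.2‖⁻¹ : ℝ) : ℂ)) := by
        rw [integral_integral_swap hF2]
        congr 1
        refine integral_congr_ae ?_
        filter_upwards [hx0] with x hx
        rw [integral_const_mul, integral_complex_ofReal, integral_heatKernel (norm_pos_iff.2 hx)]
        push_cast
        ring
    _ = _ := by
        have hpi : (π : ℂ) ≠ 0 := by exact_mod_cast Real.pi_ne_zero
        rw [integral_const_mul]
        field_simp

section LinearChangeOfVariables

variable {E : Type*} [NormedAddCommGroup E] [NormedSpace ℝ E] [FiniteDimensional ℝ E]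
  [MeasurableSpace E] [BorelSpace E] (μ : Measure E) [μ.IsAddHaarMeasure]

lemma map_continuousLinearEquiv_addHaar (e : E ≃L[ℝ] E) :
    Measure.map e.toHomeomorph.toMeasurableEquiv μ =
      ENNReal.ofReal |(LinearMap.det (e : E →ₗ[ℝ] E))⁻¹| • μ :=
  Measure.map_linearMap_addHaar_eq_smul_addHaar μ (LinearEquiv.isUnit_det' e.toLinearEquiv).ne_zero

lemma integral_comp_continuousLinearEquiv (e : E ≃L[ℝ] E) (f : E → ℂ) :
    ∫ x, f (e x) ∂μ = ((|LinearMap.det (e : E →ₗ[ℝ] E)|⁻¹ : ℝ) : ℂ) * ∫ x, f x ∂μ := by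
  have h := integral_map_equiv (μ := μ) e.toHomeomorph.toMeasurableEquiv f
  rw [map_continuousLinearEquiv_addHaar, integral_smul_measure,
    ENNReal.toReal_ofReal (abs_nonneg _), abs_inv, Complex.real_smul] at h
  exact h.symm

lemma integrable_comp_continuousLinearEquiv (e : E ≃L[ℝ] E) (f : E → ℂ) :
    Integrable (fun x => f (e x)) μ ↔ Integrable f μ := by
  have h := integrable_map_equiv (μ := μ) e.toHomeomorph.toMeasurableEquiv f
  have hd : LinearMap.det (e : E →ₗ[ℝ] E) ≠ 0 :=
    (LinearEquiv.isUnit_det' e.toLinearEquiv).ne_zero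
  rw [map_continuousLinearEquiv_addHaar, integrable_smul_measure (by simpa using hd)
    ENNReal.ofReal_ne_top] at h
  exact h.symm

end LinearChangeOfVariables

/-- The map `r ↦ r + a ⟪p, r⟫ p`, stretching space along `p`. -/
def stretch (p : V3) (a : ℝ) : V3 →ₗ[ℝ] V3 :=
  LinearMap.transvection (innerₛₗ ℝ p) (a • p)

lemma stretch_apply (p : V3) (a : ℝ) (r : V3) : stretch p a r = r + (⟪p, r⟫_ℝ * a) • p := by
  simp [stretch, LinearMap.transvection, smul_smul]

lemma det_stretch (p : V3) (a : ℝ) : LinearMap.det (stretch p a) = 1 + a * ‖p‖ ^ 2 := by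
  simp [stretch, LinearMap.transvection.det]

lemma inner_stretch_right (p : V3) (a : ℝ) (r s : V3) :
    ⟪r, stretch p a s⟫_ℝ = ⟪r, s⟫_ℝ + a * ⟪p, r⟫_ℝ * ⟪p, s⟫_ℝ := by
  rw [stretch_apply, inner_add_right, inner_smul_right, real_inner_comm p r]
  ring

lemma inner_stretch_left (p : V3) (a : ℝ) (r s : V3) :
    ⟪stretch p a r, s⟫_ℝ = ⟪r, stretch p a s⟫_ℝ := by
  rw [real_inner_comm, inner_stretch_right, inner_stretch_right, real_inner_comm]
  ring

lemma normSq_stretch (p : V3) (a : ℝ) (r : V3) :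
    ‖stretch p a r‖ ^ 2 = ‖r‖ ^ 2 + (2 * a + a ^ 2 * ‖p‖ ^ 2) * ⟪p, r⟫_ℝ ^ 2 := by
  rw [← real_inner_self_eq_norm_sq, inner_stretch_right, inner_stretch_left, inner_stretch_right,
    real_inner_self_eq_norm_sq, inner_stretch_right, real_inner_self_eq_norm_sq]
  ring

lemma stretch_stretch {p : V3} {a b : ℝ} (h : a + b + a * b * ‖p‖ ^ 2 = 0) (r : V3) :
    stretch p a (stretch p b r) = r := by
  have hc : ⟪p, r⟫_ℝ * b + (⟪p, r⟫_ℝ + ⟪p, r⟫_ℝ * b * ‖p‖ ^ 2) * a = 0 := by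
    linear_combination ⟪p, r⟫_ℝ * h
  simp only [stretch_apply, inner_add_right, inner_smul_right, real_inner_self_eq_norm_sq]
  rw [add_assoc, ← add_smul, hc, zero_smul, add_zero]

/-- The stretch as a continuous linear equivalence. -/
def stretchEquiv (p : V3) (a b : ℝ) (h : a + b + a * b * ‖p‖ ^ 2 = 0) : V3 ≃L[ℝ] V3 :=
  (LinearEquiv.ofLinearMap (stretch p a) (stretch p b)
    (LinearMap.ext fun r => stretch_stretch h r)
    (LinearMap.ext fun r => stretch_stretch (by linarith) r)).toContinuousLinearEquiv

lemma stretchEquiv_apply (p : V3) (a b : ℝ) (h : a + b + a * b * ‖p‖ ^ 2 = 0) (r : V3) :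
    stretchEquiv p a b h r = stretch p a r := rfl

/-- The map `(t, z) ↦ (t, B z + t v)` sending rest-frame coordinates to a moving frame. -/
def comovingEquiv (v : V3) (B : V3 ≃L[ℝ] V3) : (ℝ × V3) ≃L[ℝ] (ℝ × V3) :=
  (LinearEquiv.ofLinearMap
    ((LinearMap.fst ℝ ℝ V3).prod
      (B.toLinearMap ∘ₗ LinearMap.snd ℝ ℝ V3 + (LinearMap.fst ℝ ℝ V3).smulRight v))
    ((LinearMap.fst ℝ ℝ V3).prod
      (B.symm.toLinearMap ∘ₗ (LinearMap.snd ℝ ℝ V3 - (LinearMap.fst ℝ ℝ V3).smulRight v)))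
    (by ext <;> simp) (by ext <;> simp)).toContinuousLinearEquiv

lemma comovingEquiv_apply (v : V3) (B : V3 ≃L[ℝ] V3) (x : ℝ × V3) :
    comovingEquiv v B x = (x.1, B x.2 + x.1 • v) := rfl

/-- The quadratic form `(p·x)² - m² (x·x)` is `m²` times the squared distance in rest-frame
coordinates. -/
lemma mass_form_comoving {m w : ℝ} (hw : w ≠ 0) (p : V3) (h2 : w ^ 2 = m ^ 2 + ‖p‖ ^ 2)
    {a : ℝ} (ha : 1 + a * ‖p‖ ^ 2 = m / w) (ha' : 2 * a + a ^ 2 * ‖p‖ ^ 2 = -(1 / w ^ 2))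
    (t : ℝ) (z : V3) :
    (w * t - ⟪p, stretch p a z + t • w⁻¹ • p⟫_ℝ) ^ 2 -
      m ^ 2 * (t ^ 2 - ‖stretch p a z + t • w⁻¹ • p‖ ^ 2) = m ^ 2 * ‖z‖ ^ 2 := by
  have hP : ‖p‖ ^ 2 = w ^ 2 - m ^ 2 := by linarith
  have h1 : ⟪p, stretch p a z⟫_ℝ = m / w * ⟪p, z⟫_ℝ := by
    rw [inner_stretch_right, real_inner_self_eq_norm_sq, ← ha]; ring
  rw [norm_add_sq_real, inner_add_right, normSq_stretch, ha', smul_smul, inner_smul_right,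
    inner_smul_right, real_inner_comm p (stretch p a z), h1, real_inner_self_eq_norm_sq, norm_smul, mul_pow, hP,
    Real.norm_eq_abs, sq_abs]
  field_simp
  ring

lemma minkFT_comoving (J : ℝ × V3 → ℂ) (p : V3) (w : ℝ) {a b : ℝ}
    (h : a + b + a * b * ‖p‖ ^ 2 = 0) (r : V3) :
    minkFT J (⟪p, r⟫_ℝ / w, r) =
      ((|LinearMap.det (comovingEquiv (w⁻¹ • p) (stretchEquiv p a b h) :
        (ℝ × V3) →ₗ[ℝ] (ℝ × V3))| : ℝ) : ℂ) *
      minkFT (fun x => J (comovingEquiv (w⁻¹ • p) (stretchEquiv p a b h) x))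
        (0, stretch p a r) := by
  set L := comovingEquiv (w⁻¹ • p) (stretchEquiv p a b h) with hL
  set d := |LinearMap.det (L : (ℝ × V3) →ₗ[ℝ] (ℝ × V3))| with hd
  have hd0 : (d : ℂ) ≠ 0 := by
    exact_mod_cast abs_ne_zero.2 (LinearEquiv.isUnit_det' L.toLinearEquiv).ne_zero
  have hcv := integral_comp_continuousLinearEquiv volume L (fun x =>
    Complex.exp (Complex.I * ((⟪p, r⟫_ℝ / w * x.1 - ⟪r, x.2⟫_ℝ : ℝ) : ℂ)) * J x)
  have hphase : ∀ x : ℝ × V3, ⟪p, r⟫_ℝ / w * (L x).1 - ⟪r, (L x).2⟫_ℝ =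
      0 * x.1 - ⟪stretch p a r, x.2⟫_ℝ := fun x => by
    rw [hL, comovingEquiv_apply, stretchEquiv_apply, inner_add_right, inner_smul_right,
      inner_smul_right, real_inner_comm p r, inner_stretch_left]
    ring
  simp only [hphase] at hcv
  simp only [minkFT, hcv, ← hd, Complex.ofReal_inv]
  field_simp

theorem momentum_space_coulomb_integral (m : ℝ) (hm : 0 < m)
    (J : SchwartzMap (ℝ × V3) ℂ) (pv : V3) :
    Integrable (fun r : V3 =>
        minkFT (fun x => J x) (⟪pv, r⟫_ℝ / Real.sqrt (m ^ 2 + ‖pv‖ ^ 2), r) *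
          (((‖r‖ ^ 2 - (⟪pv, r⟫_ℝ / Real.sqrt (m ^ 2 + ‖pv‖ ^ 2)) ^ 2 : ℝ) : ℂ))⁻¹) ∧
    Integrable (fun x : ℝ × V3 =>
        J x * ((((Real.sqrt (m ^ 2 + ‖pv‖ ^ 2) * x.1 - ⟪pv, x.2⟫_ℝ) ^ 2 -
            m ^ 2 * (x.1 ^ 2 - ‖x.2‖ ^ 2)) ^ (-(1 : ℝ) / 2) : ℝ) : ℂ)) ∧
    ((Real.sqrt (m ^ 2 + ‖pv‖ ^ 2) : ℂ))⁻¹ *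
        (∫ r : V3,
          minkFT (fun x => J x) (⟪pv, r⟫_ℝ / Real.sqrt (m ^ 2 + ‖pv‖ ^ 2), r) *
            (((‖r‖ ^ 2 - (⟪pv, r⟫_ℝ / Real.sqrt (m ^ 2 + ‖pv‖ ^ 2)) ^ 2 : ℝ) : ℂ))⁻¹) =
      (π : ℂ) *
        ∫ x : ℝ × V3,
          J x * ((((Real.sqrt (m ^ 2 + ‖pv‖ ^ 2) * x.1 - ⟪pv, x.2⟫_ℝ) ^ 2 -
              m ^ 2 * (x.1 ^ 2 - ‖x.2‖ ^ 2)) ^ (-(1 : ℝ) / 2) : ℝ) : ℂ) := by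
  set w := √(m ^ 2 + ‖pv‖ ^ 2) with hw
  have hw0 : 0 < w := by positivity
  have h2 : w ^ 2 = m ^ 2 + ‖pv‖ ^ 2 := Real.sq_sqrt (by positivity)
  have hP : ‖pv‖ ^ 2 = w ^ 2 - m ^ 2 := by linarith
  have hwm : w + m ≠ 0 := by positivity
  obtain ⟨a, b, hab, ha, ha'⟩ : ∃ a b : ℝ, a + b + a * b * ‖pv‖ ^ 2 = 0 ∧
      1 + a * ‖pv‖ ^ 2 = m / w ∧ 2 * a + a ^ 2 * ‖pv‖ ^ 2 = -(1 / w ^ 2) := by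
    refine ⟨-(1 / (w * (w + m))), 1 / (m * (w + m)), ?_, ?_, ?_⟩ <;> rw [hP] <;> field_simp <;> ring
  set B := stretchEquiv pv a b hab with hB
  set L := comovingEquiv (w⁻¹ • pv) B with hL
  set d := |LinearMap.det (L : (ℝ × V3) →ₗ[ℝ] (ℝ × V3))| with hd
  have hd0 : (d : ℂ) ≠ 0 := by
    exact_mod_cast abs_ne_zero.2 (LinearEquiv.isUnit_det' L.toLinearEquiv).ne_zero
  set J' := SchwartzMap.compCLMOfContinuousLinearEquiv ℂ L J with hJ'
  have hleft : (fun r : V3 => minkFT (fun x => J x) (⟪pv, r⟫_ℝ / w, r) *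
      (((‖r‖ ^ 2 - (⟪pv, r⟫_ℝ / w) ^ 2 : ℝ) : ℂ))⁻¹) = fun r => (d : ℂ) *
      (fun s => minkFT (fun x => J' x) (0, s) * ((‖s‖ ^ 2 : ℝ) : ℂ)⁻¹) (B r) := by
    funext r
    have hq : ‖r‖ ^ 2 - (⟪pv, r⟫_ℝ / w) ^ 2 = ‖stretch pv a r‖ ^ 2 := by
      rw [normSq_stretch, ha']; ring
    rw [hq, minkFT_comoving (fun x => J x) pv w hab, mul_assoc]
    rfl
  have hright : (fun x => (fun x : ℝ × V3 => J x * ((((w * x.1 - ⟪pv, x.2⟫_ℝ) ^ 2 -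
      m ^ 2 * (x.1 ^ 2 - ‖x.2‖ ^ 2)) ^ (-(1 : ℝ) / 2) : ℝ) : ℂ)) (L x)) =
      fun x => (m : ℂ)⁻¹ * (J' x * ((‖x.2‖⁻¹ : ℝ) : ℂ)) := by
    funext x
    have hform := mass_form_comoving hw0.ne' pv h2 ha ha' x.1 x.2
    have hpow : (m ^ 2 * ‖x.2‖ ^ 2) ^ (-(1 : ℝ) / 2) = m⁻¹ * ‖x.2‖⁻¹ := by
      rw [← mul_pow, neg_div, Real.rpow_neg (by positivity), ← Real.sqrt_eq_rpow,
        Real.sqrt_sq (by positivity), mul_inv]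
    simp only [hL, comovingEquiv_apply, hB, stretchEquiv_apply, hform, hpow, hJ',
      SchwartzMap.compCLMOfContinuousLinearEquiv_apply, Function.comp_apply]
    push_cast
    ring
  have hdetB : |LinearMap.det (B : V3 →ₗ[ℝ] V3)| = m / w := by
    rw [show (B : V3 →ₗ[ℝ] V3) = stretch pv a from rfl, det_stretch, ha, abs_of_pos (by positivity)]
  refine ⟨?_, ?_, ?_⟩
  · rw [hleft]
    exact ((integrable_comp_continuousLinearEquiv volume B _).2
      (integrable_minkFT_zero_mul_inv_normSq J')).const_mul _
  · rw [← integrable_comp_continuousLinearEquiv volume L, hright]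
    exact (integrable_schwartz_mul_inv_norm_snd J').const_mul _
  · have hcv := integral_comp_continuousLinearEquiv volume L (fun x : ℝ × V3 =>
      J x * ((((w * x.1 - ⟪pv, x.2⟫_ℝ) ^ 2 -
        m ^ 2 * (x.1 ^ 2 - ‖x.2‖ ^ 2)) ^ (-(1 : ℝ) / 2) : ℝ) : ℂ))
    rw [hright, ← hd, integral_const_mul, Complex.ofReal_inv] at hcv
    rw [hleft, integral_const_mul, integral_comp_continuousLinearEquiv volume B
      (fun s => minkFT (fun x => J' x) (0, s) * ((‖s‖ ^ 2 : ℝ) : ℂ)⁻¹), hdetB,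
      integral_minkFT_zero_mul_inv_normSq, ← (eq_inv_mul_iff_mul_eq₀ hd0).1 hcv]
    have hmc : (m : ℂ) ≠ 0 := by exact_mod_cast hm.ne'
    have hwc : (w : ℂ) ≠ 0 := by exact_mod_cast hw0.ne'
    push_cast
    field_simp

end
end
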